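/- arXiv:2605.00301 — 3 statements merged into one kernel-verified Lean document; each statement's English description precedes it below -/
import Mathlib

section
/- If $A$ is a primitive set of natural numbers contained in $[x,\infty)$ for some real $x \geq 2$, then $f(A) \leq 1 + O(1/\log x)$; that is, there is an absolute constant $C$ such that for every real $x \geq 2$ and every primitive set $A$ with every element of $A$ at least $x$, one has $\sum_{a \in A} \frac{1}{a \log a} \leq 1 + \frac{C}{\log x}$. -/
/-- A set of natural numbers is primitive if no element divides another distinct element. -/
def Primitive (A : Set ℕ) : Prop := ∀ a ∈ A, ∀ b ∈ A, a ≠ b → ¬ a ∣ b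

open ArithmeticFunction in
theorem sum_vonMangoldt_mul_div_eq_log_factorial (N : ℕ) :
    ∑ q ∈ Finset.Ioc 0 N, Λ q * ((N / q : ℕ) : ℝ) = Real.log N.factorial := by
  rw [← ArithmeticFunction.sum_Ioc_mul_zeta_eq_sum, vonMangoldt_mul_zeta]
  induction N with
  | zero => simp
  | succ n ih =>
    rw [Finset.sum_Ioc_succ_top (Nat.zero_le n), ih, Nat.factorial_succ, Nat.cast_mul,
      Real.log_mul (by positivity) (by positivity), log_apply, add_comm]

open ArithmeticFunction in
theorem log_sub_one_le_sum_vonMangoldt_div {N : ℕ} (hN : 1 ≤ N) :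
    Real.log N - 1 ≤ ∑ q ∈ Finset.Ioc 0 N, Λ q / q := by
  have hN' : (0 : ℝ) < N := by exact_mod_cast hN
  have h1 : Real.log N.factorial ≤ N * ∑ q ∈ Finset.Ioc 0 N, Λ q / q := by
    rw [← sum_vonMangoldt_mul_div_eq_log_factorial, Finset.mul_sum]
    refine Finset.sum_le_sum fun q _ => ?_
    calc Λ q * ((N / q : ℕ) : ℝ) ≤ Λ q * ((N : ℝ) / q) :=
          mul_le_mul_of_nonneg_left Nat.cast_div_le vonMangoldt_nonneg
      _ = N * (Λ q / q) := by ring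
  have h2 : (N : ℝ) * Real.log N - N ≤ Real.log N.factorial := by
    have h := Real.log_le_log (by positivity) (Real.pow_div_factorial_le_exp _ hN'.le N)
    rw [Real.log_exp, Real.log_div (by positivity) (by positivity), Real.log_pow] at h
    linarith
  refine le_of_mul_le_mul_left ?_ hN'
  linarith

open ArithmeticFunction in
theorem sum_vonMangoldt_div_le_log_add {N : ℕ} (hN : 1 ≤ N) :
    ∑ q ∈ Finset.Ioc 0 N, Λ q / q ≤ Real.log N + (Real.log 4 + 4) := by
  have hN' : (0 : ℝ) < N := by exact_mod_cast hN
  have h1 : N * ∑ q ∈ Finset.Ioc 0 N, Λ q / q ≤ Real.log N.factorial + Chebyshev.psi N := by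
    rw [← sum_vonMangoldt_mul_div_eq_log_factorial, Finset.mul_sum, Chebyshev.psi,
      Nat.floor_natCast, ← Finset.sum_add_distrib]
    refine Finset.sum_le_sum fun q _ => ?_
    calc (N : ℝ) * (Λ q / q) = Λ q * ((N : ℝ) / q) := by ring
      _ ≤ Λ q * (((N / q : ℕ) : ℝ) + 1) := by
          refine mul_le_mul_of_nonneg_left ?_ vonMangoldt_nonneg
          rw [← Nat.floor_div_eq_div (K := ℝ)]
          exact (Nat.lt_floor_add_one _).le
      _ = _ := by ring
  have h2 : Real.log N.factorial ≤ N * Real.log N := by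
    rw [← Real.log_pow]
    exact Real.log_le_log (by positivity) (by exact_mod_cast Nat.factorial_le_pow N)
  have h3 := Chebyshev.psi_le_const_mul_self hN'.le
  refine le_of_mul_le_mul_left ?_ hN'
  linarith

/-- Abel summation against a decreasing weight `g` dominated by the decrements of `Φ`. -/
theorem sum_mul_le_of_sum_le {c v : ℕ → ℝ} {g Φ : ℝ → ℝ} {v₀ K : ℝ} {k : ℕ}
    (hv₀ : 0 < v₀) (hvk : v₀ ≤ v k) (hv : MonotoneOn v (Set.Ici k)) (hK : 0 ≤ K)
    (hg : AntitoneOn g (Set.Ioi 0)) (hg0 : ∀ a, 0 < a → 0 ≤ g a) (hΦ0 : ∀ a, 0 < a → 0 ≤ Φ a)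
    (hΦ : ∀ a b, 0 < a → a ≤ b → g b * (b - a) ≤ Φ a - Φ b)
    (hc : ∀ M, k ≤ M → ∑ q ∈ Finset.Icc k M, c q ≤ v M - v₀ + K) (M : ℕ) :
    ∑ q ∈ Finset.Icc k M, c q * g (v q) ≤ Φ v₀ + K * g v₀ := by
  have key : ∀ M, k ≤ M → ∑ q ∈ Finset.Icc k M, c q * g (v q) ≤
      Φ v₀ - Φ (v M) + K * g v₀ + g (v M) * (∑ q ∈ Finset.Icc k M, c q - (v M - v₀ + K)) := by
    intro M hM
    induction M, hM using Nat.le_induction with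
    | base =>
      have h1 := hΦ _ _ hv₀ hvk
      have h2 := mul_le_mul_of_nonneg_left
        (hg (Set.mem_Ioi.2 hv₀) (Set.mem_Ioi.2 (hv₀.trans_le hvk)) hvk) hK
      simp only [Finset.Icc_self, Finset.sum_singleton]
      linarith
    | succ M hM ih =>
      have hvM : 0 < v M := hv₀.trans_le (hvk.trans (hv Set.self_mem_Ici hM hM))
      have hle : v M ≤ v (M + 1) := hv hM (Set.mem_Ici.2 (hM.trans M.le_succ)) M.le_succ
      have h1 := hΦ _ _ hvM hle
      have h2 := hg (Set.mem_Ioi.2 hvM) (Set.mem_Ioi.2 (hvM.trans_le hle)) hle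
      have h3 := mul_nonneg (sub_nonneg.2 h2) (sub_nonneg.2 (hc M hM))
      rw [Finset.sum_Icc_succ_top (by omega), Finset.sum_Icc_succ_top (by omega)]
      linarith
  rcases le_or_gt k M with hM | hM
  · have hvM : 0 < v M := hv₀.trans_le (hvk.trans (hv Set.self_mem_Ici hM hM))
    have h1 := mul_nonneg (hg0 _ hvM) (sub_nonneg.2 (hc M hM))
    linarith [key M hM, hΦ0 _ hvM]
  · rw [Finset.Icc_eq_empty (by omega), Finset.sum_empty]
    have := hΦ0 _ hv₀
    have := mul_nonneg hK (hg0 _ hv₀)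
    linarith

/-- `flow A h w N m` is the amount of mass passing through `m` when every `a ∈ A` emits mass `h a`
and a fraction `w n m` of the mass at `n` moves on to `m`. -/
noncomputable def flow (A : Finset ℕ) (h : ℕ → ℝ) (w : ℕ → ℕ → ℝ) (N : ℕ) (m : ℕ) : ℝ :=
  (if m ∈ A then h m else 0) + ∑ n ∈ (Finset.Ioc m N).attach, flow A h w N n * w n m
termination_by N - m
decreasing_by
  have := Finset.mem_Ioc.1 n.2
  omega

theorem flow_eq (A : Finset ℕ) (h : ℕ → ℝ) (w : ℕ → ℕ → ℝ) (N m : ℕ) :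
    flow A h w N m =
      (if m ∈ A then h m else 0) + ∑ n ∈ Finset.Ioc m N, flow A h w N n * w n m := by
  rw [flow, Finset.sum_attach _ fun n => flow A h w N n * w n m]

theorem exists_dvd_of_flow_ne_zero {A : Finset ℕ} {h : ℕ → ℝ} {w : ℕ → ℕ → ℝ} {N : ℕ}
    (hw : ∀ n m, w n m ≠ 0 → m ∣ n) (m : ℕ) (hm : flow A h w N m ≠ 0) : ∃ a ∈ A, m ∣ a := by
  by_cases hA : m ∈ A
  · exact ⟨m, hA, dvd_rfl⟩
  rw [flow_eq, if_neg hA, zero_add] at hm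
  obtain ⟨n, hn, hne⟩ := Finset.exists_ne_zero_of_sum_ne_zero hm
  have := Finset.mem_Ioc.1 hn
  obtain ⟨a, ha, hna⟩ := exists_dvd_of_flow_ne_zero hw n (left_ne_zero_of_mul hne)
  exact ⟨a, ha, (hw n m (right_ne_zero_of_mul hne)).trans hna⟩
termination_by N - m

theorem flow_le {A : Finset ℕ} (hA : Primitive (A : Set ℕ)) {h : ℕ → ℝ} {w : ℕ → ℕ → ℝ} {X N : ℕ}
    (hX : 1 ≤ X) (hw0 : ∀ n m, 0 ≤ w n m) (hw : ∀ n m, w n m ≠ 0 → m ∣ n)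
    (hsup : ∀ m ∈ Finset.Icc X N, ∑ n ∈ Finset.Ioc m N, h n * w n m ≤ h m)
    (m : ℕ) (hm : m ∈ Finset.Icc X N) : flow A h w N m ≤ h m := by
  have hm' := Finset.mem_Icc.1 hm
  rw [flow_eq]
  by_cases hmA : m ∈ A
  · rw [if_pos hmA, Finset.sum_eq_zero, add_zero]
    intro n hn
    by_contra hne
    have hn' := Finset.mem_Ioc.1 hn
    obtain ⟨a, ha, hna⟩ := exists_dvd_of_flow_ne_zero hw n (left_ne_zero_of_mul hne)
    have hmn := hw n m (right_ne_zero_of_mul hne)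
    have hma : m = a := by
      by_contra hma
      exact hA m hmA a ha hma (hmn.trans hna)
    subst hma
    exact absurd (Nat.le_of_dvd (by omega) hna) (by omega)
  · rw [if_neg hmA, zero_add]
    refine le_trans (Finset.sum_le_sum fun n hn => ?_) (hsup m hm)
    have hn' := Finset.mem_Ioc.1 hn
    exact mul_le_mul_of_nonneg_right
      (flow_le hA hX hw0 hw hsup n (Finset.mem_Icc.2 (by omega))) (hw0 n m)
termination_by N - m

theorem sum_le_sum_sum_of_flow {A : Finset ℕ} (hA : Primitive (A : Set ℕ)) {h : ℕ → ℝ}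
    {w : ℕ → ℕ → ℝ} {X N : ℕ} (hX : 1 ≤ X) (hAXN : A ⊆ Finset.Icc X N)
    (hw0 : ∀ n m, 0 ≤ w n m) (hw : ∀ n m, w n m ≠ 0 → m ∣ n)
    (hsup : ∀ m ∈ Finset.Icc X N, ∑ n ∈ Finset.Ioc m N, h n * w n m ≤ h m)
    (hmass : ∀ n ∈ Finset.Icc X N, ∑ m ∈ Finset.range n, w n m = 1) :
    ∑ a ∈ A, h a ≤ ∑ m ∈ Finset.range X, ∑ n ∈ Finset.Icc X N, h n * w n m := by
  set H := flow A h w N with hH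
  have h1 : ∑ m ∈ Finset.Icc X N, H m =
      ∑ a ∈ A, h a + ∑ m ∈ Finset.Icc X N, ∑ n ∈ Finset.Ioc m N, H n * w n m := by
    rw [Finset.sum_congr rfl fun m _ => flow_eq A h w N m, Finset.sum_add_distrib,
      Finset.sum_ite_mem, Finset.inter_eq_right.2 hAXN]
  have h2 : ∑ n ∈ Finset.Icc X N, H n =
      ∑ n ∈ Finset.Icc X N, ∑ m ∈ Finset.range X, H n * w n m +
        ∑ n ∈ Finset.Icc X N, ∑ m ∈ Finset.Ico X n, H n * w n m := by
    rw [← Finset.sum_add_distrib]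
    refine Finset.sum_congr rfl fun n hn => ?_
    rw [Finset.sum_range_add_sum_Ico _ (Finset.mem_Icc.1 hn).1, ← Finset.mul_sum, hmass n hn,
      mul_one]
  have h3 : ∑ n ∈ Finset.Icc X N, ∑ m ∈ Finset.Ico X n, H n * w n m =
      ∑ m ∈ Finset.Icc X N, ∑ n ∈ Finset.Ioc m N, H n * w n m := by
    refine Finset.sum_comm' fun n m => ?_
    simp only [Finset.mem_Icc, Finset.mem_Ico, Finset.mem_Ioc]
    omega
  have h4 : ∑ a ∈ A, h a = ∑ n ∈ Finset.Icc X N, ∑ m ∈ Finset.range X, H n * w n m := by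
    linarith
  rw [h4, Finset.sum_comm]
  exact Finset.sum_le_sum fun m _ => Finset.sum_le_sum fun n hn =>
    mul_le_mul_of_nonneg_right (flow_le hA hX hw0 hw hsup n hn) (hw0 n m)

/-- The fraction of mass that moves from `n` to its divisor `m`. -/
noncomputable def vonMangoldtWeight (n m : ℕ) : ℝ :=
  if m ∣ n then ArithmeticFunction.vonMangoldt (n / m) / Real.log n else 0

theorem vonMangoldtWeight_nonneg (n m : ℕ) : 0 ≤ vonMangoldtWeight n m := by
  unfold vonMangoldtWeight
  split_ifs
  · exact div_nonneg ArithmeticFunction.vonMangoldt_nonneg (Real.log_natCast_nonneg n)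
  · exact le_rfl

theorem dvd_of_vonMangoldtWeight_ne_zero (n m : ℕ) (h : vonMangoldtWeight n m ≠ 0) : m ∣ n := by
  by_contra hmn
  exact h (if_neg hmn)

theorem vonMangoldtWeight_mul {m q : ℕ} (hm : 0 < m) :
    vonMangoldtWeight (m * q) m =
      ArithmeticFunction.vonMangoldt q / Real.log ((m * q : ℕ) : ℝ) := by
  rw [vonMangoldtWeight, if_pos (dvd_mul_right m q), Nat.mul_div_cancel_left q hm]

theorem sum_range_vonMangoldtWeight {n : ℕ} (hn : 2 ≤ n) :
    ∑ m ∈ Finset.range n, vonMangoldtWeight n m = 1 := by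
  have hlog : Real.log n ≠ 0 := (Real.log_pos (by exact_mod_cast hn)).ne'
  have h1 := Nat.sum_div_divisors n ArithmeticFunction.vonMangoldt
  rw [ArithmeticFunction.vonMangoldt_sum, ← Nat.cons_self_properDivisors (by omega),
    Finset.sum_cons, Nat.div_self (by omega), ArithmeticFunction.vonMangoldt_apply_one, zero_add] at h1
  have h2 : n.properDivisors = (Finset.range n).filter (· ∣ n) := by
    ext m
    simp [Nat.mem_properDivisors, and_comm]
  simp only [vonMangoldtWeight]
  rw [← Finset.sum_filter, ← h2, ← Finset.sum_div, h1, div_self hlog]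

/-- A perturbation of `1 / (n * log n)` that is superharmonic for the weights
`vonMangoldtWeight` at all large `n`. -/
noncomputable def potential (B : ℝ) (n : ℕ) : ℝ :=
  1 / n * (1 / Real.log n + B / Real.log n ^ 2)

theorem sum_vonMangoldt_div_Icc_le {m Y k M : ℕ} (hmY : m ≤ Y)
    (hk : m * k < Y + m) (hk' : Y ≤ m * k) (hk1 : 1 ≤ k) (hkM : k ≤ M) (hm : 1 ≤ m) :
    ∑ q ∈ Finset.Icc k M, ArithmeticFunction.vonMangoldt q / q ≤
      Real.log ((m * M : ℕ) : ℝ) - Real.log Y + (Real.log 4 + 6) := by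
  have hM := sum_vonMangoldt_div_le_log_add (hk1.trans hkM)
  have hm0 : (m : ℝ) ≠ 0 := by positivity
  have hM0 : (M : ℝ) ≠ 0 := by
    have : 0 < M := by omega
    positivity
  rw [Nat.cast_mul, Real.log_mul hm0 hM0]
  obtain ⟨j, rfl⟩ : ∃ j, k = j + 1 := ⟨k - 1, by omega⟩
  rw [Finset.Icc_add_one_left_eq_Ioc]
  rcases Nat.eq_zero_or_pos j with rfl | hj
  · have : Y = m := by omega
    subst this
    linarith
  · have hj0 : (0 : ℝ) < j := by exact_mod_cast hj
    have hsplit := Finset.sum_Ioc_consecutive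
      (fun q : ℕ => ArithmeticFunction.vonMangoldt q / (q : ℝ)) (Nat.zero_le j)
      (show j ≤ M by omega)
    have hlow := log_sub_one_le_sum_vonMangoldt_div hj
    have hY : Real.log Y ≤ Real.log m + Real.log 2 + Real.log j := by
      rw [← Real.log_mul hm0 two_ne_zero, ← Real.log_mul (by positivity) hj0.ne']
      refine Real.log_le_log (by exact_mod_cast hm.trans hmY) ?_
      have : Y ≤ m * 2 * j := by nlinarith
      exact_mod_cast this
    have := Real.log_two_lt_d9
    linarith

theorem sum_potential_mul_vonMangoldtWeight_le {B : ℝ} (hB : 0 ≤ B) {m Y : ℕ} (N : ℕ)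
    (hm : 1 ≤ m) (hmY : m ≤ Y) (hY : 2 ≤ Y) :
    ∑ n ∈ Finset.Icc Y N, potential B n * vonMangoldtWeight n m ≤
      1 / m * (1 / Real.log Y + B / (2 * Real.log Y ^ 2) +
        (Real.log 4 + 6) * (1 / Real.log Y ^ 2 + B / Real.log Y ^ 3)) := by
  obtain ⟨k, hk, hk'⟩ : ∃ k, m * k < Y + m ∧ Y ≤ m * k := by
    refine ⟨(Y + m - 1) / m, ?_, ?_⟩
    · have := Nat.mul_div_le (Y + m - 1) m
      omega
    · have := Nat.lt_mul_div_succ (Y + m - 1) hm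
      rw [mul_add] at this
      omega
  have hk1 : 1 ≤ k := by
    by_contra h
    obtain rfl : k = 0 := by omega
    omega
  have hY0 : (0 : ℝ) < Y := by positivity
  have hlogY : 0 < Real.log Y := Real.log_pos (by exact_mod_cast hY)
  have hle : ∑ n ∈ Finset.Icc Y N, potential B n * vonMangoldtWeight n m ≤
      ∑ q ∈ Finset.Icc k N, potential B (m * q) * vonMangoldtWeight (m * q) m := by
    rw [← Finset.sum_image (s := Finset.Icc k N) (g := fun q => m * q)
      (f := fun n => potential B n * vonMangoldtWeight n m)
      fun a _ b _ hab => Nat.eq_of_mul_eq_mul_left hm hab]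
    rw [← Finset.sum_filter_of_ne (p := fun n => m ∣ n)
      fun n _ hn => dvd_of_vonMangoldtWeight_ne_zero n m (right_ne_zero_of_mul hn)]
    refine Finset.sum_le_sum_of_subset_of_nonneg ?_ fun n _ _ =>
      mul_nonneg (by unfold potential; positivity) (vonMangoldtWeight_nonneg n m)
    intro n hn
    obtain ⟨hn, q, rfl⟩ := Finset.mem_filter.1 hn
    have hn := Finset.mem_Icc.1 hn
    refine Finset.mem_image.2 ⟨q, Finset.mem_Icc.2 ⟨?_, ?_⟩, rfl⟩
    · have : m * k < m * (q + 1) := by rw [mul_add]; omega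
      exact Nat.lt_succ_iff.1 (Nat.lt_of_mul_lt_mul_left this)
    · exact (Nat.le_mul_of_pos_left q hm).trans hn.2
  have heq : ∑ q ∈ Finset.Icc k N, potential B (m * q) * vonMangoldtWeight (m * q) m =
      1 / m * ∑ q ∈ Finset.Icc k N, ArithmeticFunction.vonMangoldt q / q *
        (fun v : ℝ => 1 / v ^ 2 + B / v ^ 3) (Real.log ((m * q : ℕ) : ℝ)) := by
    rw [Finset.mul_sum]
    refine Finset.sum_congr rfl fun q hq => ?_
    have hq := Finset.mem_Icc.1 hq
    have hlog : 0 < Real.log ((m * q : ℕ) : ℝ) := by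
      refine Real.log_pos ?_
      have : m * k ≤ m * q := Nat.mul_le_mul_left m hq.1
      exact_mod_cast (by omega : 1 < m * q)
    have hq0 : (q : ℝ) ≠ 0 := by exact_mod_cast (by omega : q ≠ 0)
    rw [vonMangoldtWeight_mul hm, potential]
    generalize Real.log ((m * q : ℕ) : ℝ) = v at hlog
    push_cast
    field_simp
  rw [heq] at hle
  refine hle.trans (mul_le_mul_of_nonneg_left ?_ (by positivity))
  refine sum_mul_le_of_sum_le (g := fun v => 1 / v ^ 2 + B / v ^ 3)
    (v := fun q => Real.log ((m * q : ℕ) : ℝ))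
    (Φ := fun v => 1 / v + B / (2 * v ^ 2)) hlogY
    (Real.log_le_log hY0 (by exact_mod_cast hk')) ?_ ?_ ?_ ?_ ?_ ?_
    (fun M hM => sum_vonMangoldt_div_Icc_le hmY hk hk' hk1 hM hm) N
  · intro a ha b _ hab
    have ha' : k ≤ a := ha
    refine Real.log_le_log ?_ (by exact_mod_cast Nat.mul_le_mul_left m hab)
    exact_mod_cast Nat.mul_pos hm (by omega)
  · have := Real.log_nonneg (show (1 : ℝ) ≤ 4 by norm_num)
    linarith
  · intro a ha b _ hab
    have ha' : 0 < a := ha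
    dsimp only
    gcongr
  · intro a ha
    positivity
  · intro a ha
    positivity
  · intro a b ha hab
    have hb : 0 < b := ha.trans_le hab
    have h : 1 / a + B / (2 * a ^ 2) - (1 / b + B / (2 * b ^ 2)) -
        (1 / b ^ 2 + B / b ^ 3) * (b - a) =
        (b - a) ^ 2 / (a * b ^ 2) + B * ((b - a) ^ 2 * (b + 2 * a) / (2 * a ^ 2 * b ^ 3)) := by
      field_simp
      ring
    have h' : 0 ≤ (b - a) ^ 2 / (a * b ^ 2) +
        B * ((b - a) ^ 2 * (b + 2 * a) / (2 * a ^ 2 * b ^ 3)) := by positivity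
    linarith

theorem sum_potential_mul_vonMangoldtWeight_le_of_le_log {m Y : ℕ} (N : ℕ)
    (hm : 1 ≤ m) (hmY : m ≤ Y) (hY : 4 * (Real.log 4 + 6) ≤ Real.log Y) :
    ∑ n ∈ Finset.Icc Y N, potential (4 * (Real.log 4 + 6)) n * vonMangoldtWeight n m ≤
      1 / m * (1 / Real.log Y + 4 * (Real.log 4 + 6) / Real.log Y ^ 2) := by
  have h4 : 0 ≤ Real.log 4 := Real.log_nonneg (by norm_num)
  have hY2 : 2 ≤ Y := by
    by_contra h
    have : Real.log Y ≤ 0 :=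
      Real.log_nonpos (by positivity) (by exact_mod_cast (by omega : Y ≤ 1))
    linarith
  refine (sum_potential_mul_vonMangoldtWeight_le (by positivity) N hm hmY hY2).trans
    (mul_le_mul_of_nonneg_left ?_ (by positivity))
  generalize Real.log Y = L at hY
  generalize Real.log 4 + 6 = K, (by positivity : 0 < Real.log 4 + 6) = hK at hY ⊢
  have hL : 0 < L := by linarith
  have h : 1 / L + 4 * K / L ^ 2 -
      (1 / L + 4 * K / (2 * L ^ 2) + K * (1 / L ^ 2 + 4 * K / L ^ 3)) =
      K * (L - 4 * K) / L ^ 3 := by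
    field_simp
    ring
  have h' : 0 ≤ K * (L - 4 * K) / L ^ 3 :=
    div_nonneg (mul_nonneg hK.le (by linarith)) (by positivity)
  linarith

theorem sum_range_one_div_le (X : ℕ) :
    ∑ m ∈ Finset.range X, (1 : ℝ) / m ≤ 1 + Real.log X := by
  refine le_trans ?_ (harmonic_le_one_add_log X)
  rw [harmonic, Rat.cast_sum, ← Finset.sum_range_succ_sub_top, Finset.sum_range_succ']
  simp

theorem Primitive.mono {A B : Set ℕ} (hB : Primitive B) (h : A ⊆ B) : Primitive A :=
  fun a ha b hb => hB a (h ha) b (h hb)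

theorem Primitive.sum_le_of_le_log {A : Finset ℕ} (hA : Primitive (A : Set ℕ)) {X : ℕ}
    (hX : 4 * (Real.log 4 + 6) ≤ Real.log X) (hAX : ∀ a ∈ A, X ≤ a) :
    ∑ a ∈ A, 1 / ((a : ℝ) * Real.log a) ≤
      1 + (2 + 4 * (Real.log 4 + 6)) / Real.log X := by
  have h4 : 0 ≤ Real.log 4 := Real.log_nonneg (by norm_num)
  have hX2 : 2 ≤ X := by
    by_contra h
    have : Real.log X ≤ 0 :=
      Real.log_nonpos (by positivity) (by exact_mod_cast (by omega : X ≤ 1))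
    linarith
  set B := 4 * (Real.log 4 + 6) with hB
  have hB0 : 0 ≤ B := by positivity
  set N := A.sup id
  have hAN : A ⊆ Finset.Icc X N := fun a ha =>
    Finset.mem_Icc.2 ⟨hAX a ha, Finset.le_sup (f := id) ha⟩
  have hflow : ∑ a ∈ A, potential B a ≤
      ∑ m ∈ Finset.range X, ∑ n ∈ Finset.Icc X N, potential B n * vonMangoldtWeight n m := by
    refine sum_le_sum_sum_of_flow hA (by omega) hAN vonMangoldtWeight_nonneg
      dvd_of_vonMangoldtWeight_ne_zero (fun m hm => ?_) fun n hn =>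
        sum_range_vonMangoldtWeight (hX2.trans (Finset.mem_Icc.1 hn).1)
    have hm := (Finset.mem_Icc.1 hm).1
    have hlog : Real.log X ≤ Real.log m :=
      Real.log_le_log (by positivity) (by exact_mod_cast hm)
    refine le_trans (Finset.sum_le_sum_of_subset_of_nonneg Finset.Ioc_subset_Icc_self
      fun n _ _ => mul_nonneg (by unfold potential; positivity) (vonMangoldtWeight_nonneg n m)) ?_
    exact sum_potential_mul_vonMangoldtWeight_le_of_le_log N (by omega) le_rfl (hX.trans hlog)
  have hL : 0 < Real.log X := by linarith
  calc ∑ a ∈ A, 1 / ((a : ℝ) * Real.log a)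
      ≤ ∑ a ∈ A, potential B a := by
        refine Finset.sum_le_sum fun a _ => ?_
        rw [potential, ← one_div_mul_one_div]
        exact mul_le_mul_of_nonneg_left (le_add_of_nonneg_right (by positivity)) (by positivity)
    _ ≤ _ := hflow
    _ ≤ ∑ m ∈ Finset.range X, 1 / (m : ℝ) * (1 / Real.log X + B / Real.log X ^ 2) := by
        refine Finset.sum_le_sum fun m hm => ?_
        have hm := Finset.mem_range.1 hm
        rcases Nat.eq_zero_or_pos m with rfl | hm0
        · rw [Finset.sum_eq_zero fun n hn => ?_]
          · simp
          have hn := (Finset.mem_Icc.1 hn).1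
          rw [vonMangoldtWeight, if_neg (by rw [zero_dvd_iff]; omega), mul_zero]
        · exact sum_potential_mul_vonMangoldtWeight_le_of_le_log N hm0 hm.le hX
    _ ≤ (1 + Real.log X) * (1 / Real.log X + B / Real.log X ^ 2) := by
        rw [← Finset.sum_mul]
        exact mul_le_mul_of_nonneg_right (sum_range_one_div_le X) (by positivity)
    _ ≤ 1 + (2 + B) / Real.log X := by
        generalize Real.log X = L at hL hX
        have h : 1 + (2 + B) / L - (1 + L) * (1 / L + B / L ^ 2) = (L - B) / L ^ 2 := by
          field_simp
          ring
        have : 0 ≤ (L - B) / L ^ 2 := div_nonneg (by linarith) (by positivity)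
        linarith

theorem erdos_1196 :
    ∃ C : ℝ, ∀ x : ℝ, 2 ≤ x → ∀ A : Set ℕ, Primitive A → (∀ a ∈ A, x ≤ (a : ℝ)) →
      ∑' a : A, 1 / (((a : ℕ) : ℝ) * Real.log ((a : ℕ) : ℝ)) ≤ 1 + C / Real.log x := by
  have h4 : 0 ≤ Real.log 4 := Real.log_nonneg (by norm_num)
  obtain ⟨X₀, hX₀⟩ : ∃ X₀ : ℕ, 4 * (Real.log 4 + 6) ≤ Real.log X₀ := by
    refine ⟨⌈Real.exp (4 * (Real.log 4 + 6))⌉₊, ?_⟩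
    rw [← Real.log_exp (4 * (Real.log 4 + 6))]
    exact Real.log_le_log (Real.exp_pos _) (by rw [Real.log_exp]; exact Nat.le_ceil _)
  set D := 2 + 4 * (Real.log 4 + 6) with hD
  have hD0 : 0 ≤ D := by positivity
  set S := ∑ n ∈ Finset.range X₀, 1 / ((n : ℝ) * Real.log n) with hS
  have hterm (n : ℕ) : 0 ≤ 1 / ((n : ℝ) * Real.log n) := by positivity
  have hS0 : 0 ≤ S := Finset.sum_nonneg fun n _ => hterm n
  refine ⟨D + S * Real.log X₀, fun x hx A hA hAx => ?_⟩
  have hlogx : 0 < Real.log x := Real.log_pos (by linarith)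
  refine Real.tsum_le_of_sum_le (fun a => hterm a) fun u => ?_
  set s := u.map (Function.Embedding.subtype (· ∈ A)) with hs
  have hsA : (s : Set ℕ) ⊆ A := by
    intro a ha
    obtain ⟨b, _, rfl⟩ := Finset.mem_map.1 (Finset.mem_coe.1 ha)
    exact b.2
  have hsum : ∑ a ∈ u, 1 / (((a : ℕ) : ℝ) * Real.log ((a : ℕ) : ℝ)) =
      ∑ a ∈ s, 1 / ((a : ℝ) * Real.log a) := by
    rw [hs, Finset.sum_map]
    rfl
  rw [hsum]
  rcases le_total (X₀ : ℝ) x with h | h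
  · have hceil : Real.log x ≤ Real.log ⌈x⌉₊ := Real.log_le_log (by linarith) (Nat.le_ceil x)
    have hX₀' : Real.log X₀ ≤ Real.log x := by
      refine Real.log_le_log ?_ h
      by_contra h0
      have : (X₀ : ℝ) = 0 := le_antisymm (not_lt.1 h0) (by positivity)
      rw [this, Real.log_zero] at hX₀
      linarith
    refine ((hA.mono hsA).sum_le_of_le_log (X := ⌈x⌉₊) (by linarith)
      fun a ha => Nat.ceil_le.2 (hAx a (hsA ha))).trans ?_
    have hDS : D ≤ D + S * Real.log X₀ := le_add_of_nonneg_right (by positivity)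
    rw [← hD]
    gcongr
  · have hlog : Real.log x ≤ Real.log X₀ := Real.log_le_log (by linarith) h
    rw [← Finset.sum_filter_add_sum_filter_not s (· < X₀)]
    have h1 : ∑ a ∈ s with a < X₀, 1 / ((a : ℝ) * Real.log a) ≤ S :=
      Finset.sum_le_sum_of_subset_of_nonneg
        (fun a ha => Finset.mem_range.2 (Finset.mem_filter.1 ha).2) fun n _ _ => hterm n
    have h2 : ∑ a ∈ s with ¬ a < X₀, 1 / ((a : ℝ) * Real.log a) ≤ 1 + D / Real.log X₀ :=
      (hA.mono (fun a ha => hsA (Finset.mem_filter.1 (Finset.mem_coe.1 ha)).1)).sum_le_of_le_log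
        hX₀ fun a ha => not_lt.1 (Finset.mem_filter.1 ha).2
    have h3 : D / Real.log X₀ ≤ D / Real.log x := by gcongr
    have h4 : S ≤ S * Real.log X₀ / Real.log x := by
      rw [le_div_iff₀ hlogx]
      gcongr
    rw [add_div]
    linarith
end

section
/- For every primitive set $A$ of natural numbers not containing $1$, one has $f(A) \leq f(\mathbb{N}_1)$, i.e. $\sum_{a \in A} \frac{1}{a \log a} \leq \sum_{p\ \mathrm{prime}} \frac{1}{p \log p}$ (the Erdős primitive set conjecture). -/
open Real Finset
open scoped ArithmeticFunction.vonMangoldt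

lemma log_div_rpow_three_add_five_le {s : ℝ} (hs : 0 < s) :
    log 3 / 3 ^ (1 + s) + log 5 / 5 ^ (1 + s) ≤ log 2 / 2 ^ (1 + s) + log 4 / 4 ^ (1 + s) := by
  have key : log 3 / 3 + log 5 / 5 ≤ 2 * (log 2 / 2) := by
    have h : log (3 ^ 10 * 5 ^ 6) ≤ log (2 ^ 30) := log_le_log (by norm_num) (by norm_num)
    rw [log_mul (by norm_num) (by norm_num), log_pow, log_pow, log_pow] at h
    push_cast at h
    linarith
  have h4 : log 4 = 2 * log 2 := by
    rw [show (4 : ℝ) = 2 ^ 2 by norm_num, log_pow]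
    norm_num
  have split (x : ℝ) (hx : 0 < x) : log x / x ^ (1 + s) = log x / x * x ^ (-s) := by
    rw [rpow_add hx, rpow_one, rpow_neg hx.le]
    field_simp
  rw [split 2 (by norm_num), split 3 (by norm_num), split 4 (by norm_num), split 5 (by norm_num)]
  have h35 : (5 : ℝ) ^ (-s) ≤ 3 ^ (-s) :=
    rpow_le_rpow_of_nonpos (by norm_num) (by norm_num) (by linarith)
  have h5 : (0 : ℝ) < 5 ^ (-s) := by positivity
  have convex : 2 * (3 : ℝ) ^ (-s) ≤ 2 ^ (-s) + 4 ^ (-s) := by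
    have h98 : (9 : ℝ) ^ (-s) ≤ 8 ^ (-s) :=
      rpow_le_rpow_of_nonpos (by norm_num) (by norm_num) (by linarith)
    rw [show (9 : ℝ) = 3 * 3 by norm_num, show (8 : ℝ) = 2 * 4 by norm_num,
      mul_rpow (by norm_num) (by norm_num), mul_rpow (by norm_num) (by norm_num)] at h98
    refine le_of_sq_le_sq ?_ (by positivity)
    nlinarith [sq_nonneg ((2 : ℝ) ^ (-s) - 4 ^ (-s))]
  have hl5 : 0 ≤ log 5 := log_nonneg (by norm_num)
  have hl2 : 0 ≤ log 2 := log_nonneg (by norm_num)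
  rw [h4]
  nlinarith [mul_nonneg hl2 (sub_nonneg.2 convex), mul_nonneg (sub_nonneg.2 key) h5.le,
    mul_nonneg (show 0 ≤ 2 * (log 2 / 2) - log 3 / 3 by linarith) (sub_nonneg.2 h35)]

lemma summable_log_div_rpow {s : ℝ} (hs : 0 < s) :
    Summable fun n : ℕ ↦ log n / (n : ℝ) ^ (1 + s) := by
  refine Summable.of_nonneg_of_le (fun n ↦ by positivity) (fun n ↦ ?_)
    ((summable_nat_rpow_inv.2 (show 1 < 1 + s / 2 by linarith)).mul_left (s / 2)⁻¹)
  rcases n.eq_zero_or_pos with rfl | hn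
  · simp
    positivity
  have hn' : (0 : ℝ) < n := by exact_mod_cast hn
  have h := log_le_rpow_div hn'.le (half_pos hs)
  rw [div_le_iff₀ (by positivity)]
  refine h.trans (le_of_eq ?_)
  rw [show 1 + s = (1 + s / 2) + s / 2 by ring, rpow_add hn' (1 + s / 2)]
  field_simp

lemma tsum_odd_log_div_rpow_le {s : ℝ} (hs : 0 < s) :
    ∑' k : ℕ, log ((2 * k + 1 : ℕ) : ℝ) / ((2 * k + 1 : ℕ) : ℝ) ^ (1 + s) ≤
      ∑' k : ℕ, log ((2 * k : ℕ) : ℝ) / ((2 * k : ℕ) : ℝ) ^ (1 + s) := by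
  have hg := summable_log_div_rpow hs
  have ho : Summable fun k : ℕ ↦ log ((2 * k + 1 : ℕ) : ℝ) / ((2 * k + 1 : ℕ) : ℝ) ^ (1 + s) :=
    hg.comp_injective (i := fun k ↦ 2 * k + 1) fun a b h ↦ by simpa using h
  have he : Summable fun k : ℕ ↦ log ((2 * k : ℕ) : ℝ) / ((2 * k : ℕ) : ℝ) ^ (1 + s) :=
    hg.comp_injective (i := fun k ↦ 2 * k) fun a b h ↦ by simpa using h
  rw [← ho.sum_add_tsum_nat_add 3, ← he.sum_add_tsum_nat_add 3]
  refine add_le_add ?_ (Summable.tsum_le_tsum (fun k ↦ ?_) ((summable_nat_add_iff 3).2 ho)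
    ((summable_nat_add_iff 3).2 he))
  · have := log_div_rpow_three_add_five_le hs
    norm_num [sum_range_succ]
    exact this
  · have hexp : exp (1 + s)⁻¹ ≤ 3 := by
      have h1 : (1 + s)⁻¹ ≤ 1 := inv_le_one_of_one_le₀ (by linarith)
      have := exp_le_exp.2 h1
      linarith [exp_one_lt_d9]
    have hk : (0 : ℝ) ≤ k := k.cast_nonneg
    apply log_div_self_rpow_antitoneOn (show 0 < 1 + s by linarith)
    · simp only [Set.mem_Ici]
      push_cast
      linarith
    · simp only [Set.mem_Ici]
      push_cast
      linarith
    · push_cast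
      linarith

lemma two_rpow_sub_one_mul_tsum_log_le {s : ℝ} (hs : 0 < s) :
    (2 ^ s - 1) * ∑' n : ℕ, log n / (n : ℝ) ^ (1 + s) ≤
      log 2 * ∑' n : ℕ, ((n : ℝ) ^ (1 + s))⁻¹ := by
  have hg := summable_log_div_rpow hs
  have hz : Summable fun n : ℕ ↦ ((n : ℝ) ^ (1 + s))⁻¹ := summable_nat_rpow_inv.2 (by linarith)
  have ho : Summable fun k : ℕ ↦ log ((2 * k + 1 : ℕ) : ℝ) / ((2 * k + 1 : ℕ) : ℝ) ^ (1 + s) :=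
    hg.comp_injective (i := fun k ↦ 2 * k + 1) fun a b h ↦ by simpa using h
  have he : Summable fun k : ℕ ↦ log ((2 * k : ℕ) : ℝ) / ((2 * k : ℕ) : ℝ) ^ (1 + s) :=
    hg.comp_injective (i := fun k ↦ 2 * k) fun a b h ↦ by simpa using h
  have hsplit := tsum_even_add_odd (f := fun n : ℕ ↦ log n / (n : ℝ) ^ (1 + s)) he ho
  have hle := tsum_odd_log_div_rpow_le hs
  have heven : ∑' k : ℕ, log ((2 * k : ℕ) : ℝ) / ((2 * k : ℕ) : ℝ) ^ (1 + s) =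
      (2 * 2 ^ s)⁻¹ * (log 2 * ∑' n : ℕ, ((n : ℝ) ^ (1 + s))⁻¹ +
        ∑' n : ℕ, log n / (n : ℝ) ^ (1 + s)) := by
    rw [← tsum_mul_left, ← (hz.mul_left _).tsum_add hg, ← tsum_mul_left]
    refine tsum_congr fun k ↦ ?_
    rcases k.eq_zero_or_pos with rfl | hk
    · simp [zero_rpow (show 1 + s ≠ 0 by linarith)]
    have hk' : (0 : ℝ) < k := by exact_mod_cast hk
    push_cast
    rw [log_mul (by norm_num) hk'.ne', mul_rpow (by norm_num) hk'.le,
      rpow_add (by norm_num : (0 : ℝ) < 2), rpow_one]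
    field_simp
  have h2 : (0 : ℝ) < 2 ^ s := by positivity
  rw [heven] at hle hsplit
  generalize ∑' n : ℕ, log n / (n : ℝ) ^ (1 + s) = D at *
  generalize ∑' n : ℕ, ((n : ℝ) ^ (1 + s))⁻¹ = Z at *
  have hD : D ≤ 2 * ((2 * 2 ^ s)⁻¹ * (log 2 * Z + D)) := by
    linarith
  rw [show 2 * ((2 * 2 ^ s)⁻¹ * (log 2 * Z + D)) = (log 2 * Z + D) / 2 ^ s by field_simp,
    le_div_iff₀ h2] at hD
  linarith

lemma sum_vonMangoldt_div_rpow_mul_tsum_le {s : ℝ} (hs : 0 < s) (Q : Finset ℕ) :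
    (∑ q ∈ Q, Λ q / (q : ℝ) ^ (1 + s)) * ∑' n : ℕ, ((n : ℝ) ^ (1 + s))⁻¹ ≤
      ∑' n : ℕ, log n / (n : ℝ) ^ (1 + s) := by
  have hs1 : 1 + s ≠ 0 := by linarith
  have hg := summable_log_div_rpow hs
  have hz : Summable fun n : ℕ ↦ ((n : ℝ) ^ (1 + s))⁻¹ := summable_nat_rpow_inv.2 (by linarith)
  have hdvd (q : ℕ) : Summable fun n : ℕ ↦
      if q ∣ n then Λ q * ((n : ℝ) ^ (1 + s))⁻¹ else 0 := by
    refine Summable.of_nonneg_of_le (fun n ↦ ?_) (fun n ↦ ?_) (hz.mul_left (Λ q))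
    · have := ArithmeticFunction.vonMangoldt_nonneg (n := q)
      split_ifs <;> positivity
    · have := ArithmeticFunction.vonMangoldt_nonneg (n := q)
      split_ifs
      · exact le_rfl
      · positivity
  have hmul (q : ℕ) : Λ q / (q : ℝ) ^ (1 + s) * ∑' n : ℕ, ((n : ℝ) ^ (1 + s))⁻¹ =
      ∑' n : ℕ, if q ∣ n then Λ q * ((n : ℝ) ^ (1 + s))⁻¹ else 0 := by
    rcases q.eq_zero_or_pos with rfl | hq
    · simp
    rw [← tsum_mul_left]
    have hinj : Function.Injective fun n : ℕ ↦ q * n :=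
      fun a b h ↦ Nat.eq_of_mul_eq_mul_left hq h
    rw [← hinj.tsum_eq (f := fun n ↦ if q ∣ n then Λ q * ((n : ℝ) ^ (1 + s))⁻¹ else 0)]
    · refine tsum_congr fun n ↦ ?_
      simp only [dvd_mul_right, if_true]
      push_cast
      rw [mul_rpow q.cast_nonneg n.cast_nonneg, mul_inv]
      ring
    · intro n hn
      by_contra h
      refine hn (if_neg fun ⟨c, hc⟩ ↦ h ⟨c, hc.symm⟩)
  rw [sum_mul, sum_congr rfl fun q _ ↦ hmul q, ← Summable.tsum_finsetSum fun q _ ↦ hdvd q]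
  refine Summable.tsum_le_tsum (fun n ↦ ?_) (summable_sum fun q _ ↦ hdvd q) hg
  rcases n.eq_zero_or_pos with rfl | hn
  · simp [zero_rpow hs1]
  rw [← ArithmeticFunction.vonMangoldt_sum, div_eq_mul_inv, sum_mul, ← sum_filter]
  refine sum_le_sum_of_subset_of_nonneg (fun q hq ↦ ?_) fun q _ _ ↦ ?_
  · exact Nat.mem_divisors.2 ⟨(mem_filter.1 hq).2, hn.ne'⟩
  · have := ArithmeticFunction.vonMangoldt_nonneg (n := q)
    positivity

/-- A finite form of a bound for the logarithmic derivative of the zeta function at `1 + s`. -/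
lemma mul_sum_vonMangoldt_div_rpow_le {s : ℝ} (hs : 0 < s) (Q : Finset ℕ) :
    s * ∑ q ∈ Q, Λ q / (q : ℝ) ^ (1 + s) ≤ exp (-(log 2 / 2 * s)) := by
  have hz : Summable fun n : ℕ ↦ ((n : ℝ) ^ (1 + s))⁻¹ := summable_nat_rpow_inv.2 (by linarith)
  have hZ : 0 < ∑' n : ℕ, ((n : ℝ) ^ (1 + s))⁻¹ :=
    hz.tsum_pos (fun n ↦ by positivity) 1 (by simp)
  have hl2 : 0 < log 2 := log_pos (by norm_num)
  have h1 := sum_vonMangoldt_div_rpow_mul_tsum_le hs Q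
  have h2 := two_rpow_sub_one_mul_tsum_log_le hs
  set S := ∑ q ∈ Q, Λ q / (q : ℝ) ^ (1 + s)
  have h2s : (2 : ℝ) ^ s = exp (log 2 / 2 * s) * exp (log 2 / 2 * s) := by
    rw [rpow_def_of_pos (by norm_num), ← exp_add]
    congr 1
    ring
  have hpos : 0 < (2 : ℝ) ^ s - 1 := sub_pos.2 (one_lt_rpow (by norm_num) hs)
  have hS : (2 ^ s - 1) * S ≤ log 2 := by
    refine le_of_mul_le_mul_right ?_ hZ
    calc _ = (2 ^ s - 1) * (S * ∑' n : ℕ, ((n : ℝ) ^ (1 + s))⁻¹) := by ring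
      _ ≤ _ := (mul_le_mul_of_nonneg_left h1 hpos.le).trans h2
  have hsinh : log 2 / 2 * s ≤ sinh (log 2 / 2 * s) := self_le_sinh_iff.2 (by positivity)
  rw [sinh_eq] at hsinh
  have hE := exp_pos (log 2 / 2 * s)
  rw [exp_neg] at hsinh ⊢
  set E := exp (log 2 / 2 * s)
  have hEE : log 2 * s * E ≤ 2 ^ s - 1 := by
    have := mul_le_mul_of_nonneg_right hsinh hE.le
    rw [h2s]
    field_simp at this
    nlinarith
  rw [← one_div, le_div_iff₀ hE]
  refine le_of_mul_le_mul_right ?_ hpos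
  calc s * S * E * (2 ^ s - 1) = s * E * ((2 ^ s - 1) * S) := by ring
    _ ≤ s * E * log 2 := mul_le_mul_of_nonneg_left hS (by positivity)
    _ ≤ 1 * (2 ^ s - 1) := by linarith

lemma sum_vonMangoldt_div_mul_sq_le {L : ℝ} (hL : 0 < L) (Q : Finset ℕ) :
    ∑ q ∈ Q, Λ q / (q * (L + log q) ^ 2) ≤ 1 / (L + log 2 / 2) := by
  have hl2 : 0 < log 2 := log_pos (by norm_num)
  have hpos (q : ℕ) : 0 < L + log q := by positivity
  have hint (r : ℝ) (hr : 0 < r) :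
      MeasureTheory.IntegrableOn (fun s ↦ s * exp (-(r * s))) (Set.Ioi 0) := by
    have := integrableOn_rpow_mul_exp_neg_mul_rpow (p := 1) (s := 1) (by norm_num) one_pos hr
    simpa using this
  have hval (r : ℝ) (hr : 0 < r) : ∫ s in Set.Ioi 0, s * exp (-(r * s)) = 1 / r ^ 2 := by
    have := integral_rpow_mul_exp_neg_mul_Ioi two_pos hr
    norm_num [Gamma_two] at this
    simpa using this
  have hint' : MeasureTheory.IntegrableOn (fun s ↦ exp (-(L + log 2 / 2) * s)) (Set.Ioi 0) :=
    integrableOn_exp_mul_Ioi (by linarith) 0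
  have hval' := integral_exp_mul_Ioi (show -(L + log 2 / 2) < 0 by linarith) 0
  calc ∑ q ∈ Q, Λ q / (q * (L + log q) ^ 2)
      = ∫ s in Set.Ioi 0, ∑ q ∈ Q, Λ q / q * (s * exp (-((L + log q) * s))) := by
        rw [MeasureTheory.integral_finsetSum _ fun q _ ↦ (hint _ (hpos q)).const_mul _]
        refine sum_congr rfl fun q _ ↦ ?_
        rw [MeasureTheory.integral_const_mul, hval _ (hpos q)]
        have := hpos q
        field_simp
    _ ≤ ∫ s in Set.Ioi 0, exp (-(L + log 2 / 2) * s) := by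
        refine MeasureTheory.setIntegral_mono_on
          (MeasureTheory.integrable_finsetSum _ fun q _ ↦ (hint _ (hpos q)).const_mul _)
          hint' measurableSet_Ioi fun s hs ↦ ?_
        have h := mul_sum_vonMangoldt_div_rpow_le hs Q
        calc ∑ q ∈ Q, Λ q / q * (s * exp (-((L + log q) * s)))
            = exp (-(L * s)) * (s * ∑ q ∈ Q, Λ q / (q : ℝ) ^ (1 + s)) := by
              rw [mul_sum, mul_sum]
              refine sum_congr rfl fun q _ ↦ ?_
              rcases q.eq_zero_or_pos with rfl | hq
              · simp
              have hq' : (0 : ℝ) < q := by exact_mod_cast hq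
              rw [rpow_add hq', rpow_one, rpow_def_of_pos hq', add_mul, neg_add, exp_add,
                exp_neg (log q * s)]
              field_simp
          _ ≤ exp (-(L * s)) * exp (-(log 2 / 2 * s)) := by gcongr
          _ = _ := by
              rw [← exp_add]
              congr 1
              ring
    _ = _ := by
        rw [hval', mul_zero, exp_zero, neg_div_neg_eq]

/-- The weight carried along the divisibility edge from `d` to its multiple `n`. -/
noncomputable def edgeFlow (d n : ℕ) : ℝ :=
  (Λ (n / d) + if d = n.minFac then Λ n else 0) / (n * log n ^ 2)

lemma edgeFlow_nonneg (d n : ℕ) : 0 ≤ edgeFlow d n := by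
  have h1 := ArithmeticFunction.vonMangoldt_nonneg (n := n / d)
  have h2 := ArithmeticFunction.vonMangoldt_nonneg (n := n)
  unfold edgeFlow
  split_ifs <;> positivity

/-- The flow entering a composite `n` is exactly `1 / (n log n)`. -/
lemma sum_edgeFlow_properDivisors {n : ℕ} (hn : 2 ≤ n) (hp : ¬ n.Prime) :
    ∑ d ∈ n.properDivisors.erase 1, edgeFlow d n = 1 / (n * log n) := by
  have h1 : 1 ∈ n.properDivisors := Nat.one_mem_properDivisors_iff_one_lt.2 hn
  have hlog : 0 < log n := log_pos (by exact_mod_cast hn)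
  have hn0 : (0 : ℝ) < n := by positivity
  have hmin : n.minFac ∈ n.properDivisors.erase 1 := by
    rw [mem_erase, Nat.mem_properDivisors]
    exact ⟨fun h ↦ by rw [Nat.minFac_eq_one_iff] at h; omega, n.minFac_dvd,
      (Nat.not_prime_iff_minFac_lt hn).1 hp⟩
  have hsum : ∑ d ∈ n.properDivisors.erase 1, Λ (n / d) = log n - Λ n := by
    have h := Nat.sum_div_divisors n (fun e ↦ Λ e)
    rw [ArithmeticFunction.vonMangoldt_sum, ← Nat.cons_self_properDivisors (by omega), sum_cons,
      Nat.div_self (by omega), ArithmeticFunction.vonMangoldt_apply_one,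
      ← add_sum_erase _ _ h1, Nat.div_one] at h
    linarith
  unfold edgeFlow
  rw [← sum_div, sum_add_distrib, hsum, sum_ite_eq' _ _ _, if_pos hmin]
  field_simp
  ring

lemma sum_vonMangoldt_quotient_le {d : ℕ} (hd : 2 ≤ d) (E : Finset ℕ) :
    ∑ n ∈ E with d ∣ n ∧ d < n, Λ (n / d) / (n * log n ^ 2) ≤
      1 / (d * (log d + log 2 / 2)) := by
  have hlog : 0 < log d := log_pos (by exact_mod_cast hd)
  have hd0 : (0 : ℝ) < d := by positivity
  have hinj : Set.InjOn (fun n ↦ n / d) (E.filter fun n ↦ d ∣ n ∧ d < n) := by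
    intro a ha b hb h
    rw [mem_coe, mem_filter] at ha hb
    exact Nat.div_left_inj ha.2.1 hb.2.1 |>.1 h
  calc _ = ∑ n ∈ E with d ∣ n ∧ d < n, 1 / d *
        (Λ (n / d) / ((n / d : ℕ) * (log d + log (n / d : ℕ)) ^ 2)) := by
        refine sum_congr rfl fun n hn ↦ ?_
        obtain ⟨-, ⟨q, rfl⟩, hq⟩ := mem_filter.1 hn
        have hq0 : 0 < q := Nat.pos_of_ne_zero fun h ↦ by simp [h] at hq
        have hq' : (0 : ℝ) < q := by exact_mod_cast hq0
        rw [Nat.mul_div_cancel_left q (by omega)]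
        push_cast
        rw [log_mul hd0.ne' hq'.ne']
        field_simp
    _ = 1 / d * ∑ q ∈ (E.filter fun n ↦ d ∣ n ∧ d < n).image (fun n ↦ n / d),
          Λ q / (q * (log d + log q) ^ 2) := by
        rw [sum_image hinj, mul_sum]
    _ ≤ 1 / d * (1 / (log d + log 2 / 2)) := by
        gcongr
        exact sum_vonMangoldt_div_mul_sq_le hlog _
    _ = _ := by
        field_simp

lemma sum_vonMangoldt_minFac_le {d : ℕ} (hd : 2 ≤ d) (E : Finset ℕ) :
    ∑ n ∈ E with d ∣ n ∧ d < n, (if d = n.minFac then Λ n else 0) / (n * log n ^ 2) ≤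
      1 / (4 * (d * (d - 1)) * log d) := by
  have hlog : 0 < log d := log_pos (by exact_mod_cast hd)
  have hd2 : (2 : ℝ) ≤ d := by exact_mod_cast hd
  have hnonneg (n : ℕ) : 0 ≤ (if d = n.minFac then Λ n else 0) / (n * log n ^ 2) := by
    have := ArithmeticFunction.vonMangoldt_nonneg (n := n)
    split_ifs <;> positivity
  have hinj : Set.InjOn (fun k ↦ d ^ (k + 2)) (range (E.sup id)) := by
    intro a _ b _ h
    have := Nat.pow_right_injective hd h
    omega
  calc ∑ n ∈ E with d ∣ n ∧ d < n, (if d = n.minFac then Λ n else 0) / (n * log n ^ 2)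
      ≤ ∑ n ∈ (range (E.sup id)).image (fun k ↦ d ^ (k + 2)),
          (if d = n.minFac then Λ n else 0) / (n * log n ^ 2) := by
        rw [← sum_filter_ne_zero]
        refine sum_le_sum_of_subset_of_nonneg (fun n hn ↦ ?_) fun n _ _ ↦ hnonneg n
        simp only [mem_filter] at hn
        obtain ⟨⟨hnE, hdn, hlt⟩, hne⟩ := hn
        have hmin : d = n.minFac := by
          by_contra h
          simp [h] at hne
        have hpp : IsPrimePow n := by
          rw [← ArithmeticFunction.vonMangoldt_ne_zero_iff]
          intro h
          simp [h] at hne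
        obtain ⟨k, hk, hkn⟩ := (isPrimePow_iff_minFac_pow_factorization_eq hpp.ne_one).1 hpp |>
          fun h ↦ (⟨_, (Nat.pos_of_ne_zero fun h0 ↦ hpp.ne_one (by simpa [h0] using h.symm)), h⟩ :
            ∃ k, 0 < k ∧ n.minFac ^ k = n)
        rw [← hmin] at hkn
        have hk1 : k ≠ 1 := fun h ↦ by simp [h] at hkn; omega
        rw [mem_image]
        refine ⟨k - 2, mem_range.2 ?_, by rw [Nat.sub_add_cancel (by omega), hkn]⟩
        have h1 : k < d ^ k := Nat.lt_pow_self hd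
        have h2 : n ≤ E.sup id := le_sup (f := id) hnE
        omega
    _ = ∑ k ∈ range (E.sup id), (if d = (d ^ (k + 2)).minFac then Λ (d ^ (k + 2)) else 0) /
          ((d ^ (k + 2) : ℕ) * log (d ^ (k + 2) : ℕ) ^ 2) := sum_image hinj
    _ ≤ ∑ k ∈ range (E.sup id), 1 / (4 * d ^ 2 * log d) * ((d : ℝ)⁻¹) ^ k := by
        refine sum_le_sum fun k _ ↦ ?_
        have hΛ : (if d = (d ^ (k + 2)).minFac then Λ (d ^ (k + 2)) else 0) ≤ log d := by
          split_ifs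
          · rw [ArithmeticFunction.vonMangoldt_apply_pow (by omega)]
            exact ArithmeticFunction.vonMangoldt_le_log
          · exact hlog.le
        have h2k : (2 : ℝ) ≤ k + 2 := by linarith [k.cast_nonneg (α := ℝ)]
        push_cast
        rw [log_pow]
        push_cast
        calc _ ≤ log d / (d ^ (k + 2) * (2 * log d) ^ 2) := by gcongr
          _ = _ := by
            rw [inv_pow, pow_add]
            field_simp
            norm_num
    _ ≤ 1 / (4 * d ^ 2 * log d) * (1 - (d : ℝ)⁻¹)⁻¹ := by
        rw [← mul_sum]
        gcongr
        have hr : (d : ℝ)⁻¹ < 1 := inv_lt_one_of_one_lt₀ (by linarith)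
        rw [← tsum_geometric_of_lt_one (by positivity) hr]
        exact (summable_geometric_of_lt_one (by positivity) hr).sum_le_tsum _
          fun _ _ ↦ by positivity
    _ = _ := by
        have : (d : ℝ) - 1 ≠ 0 := by linarith
        field_simp

/-- The flow leaving `d` is at most `1 / (d log d)`. -/
lemma sum_edgeFlow_le {d : ℕ} (hd : 2 ≤ d) (E : Finset ℕ) :
    ∑ n ∈ E with d ∣ n ∧ d < n, edgeFlow d n ≤ 1 / (d * log d) := by
  have hlog : 0 < log d := log_pos (by exact_mod_cast hd)
  have hl2 : 0 < log 2 := log_pos (by norm_num)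
  have hd2 : (2 : ℝ) ≤ d := by exact_mod_cast hd
  have hd1 : (0 : ℝ) < d - 1 := by linarith
  have hlog_le : log d + log 2 / 2 ≤ 2 * log 2 * (d - 1) := by
    have h := log_le_sub_one_of_pos (show (0 : ℝ) < d / 2 by positivity)
    rw [log_div (by positivity) (by norm_num)] at h
    nlinarith [log_two_gt_d9]
  unfold edgeFlow
  simp_rw [add_div]
  rw [sum_add_distrib]
  refine (add_le_add (sum_vonMangoldt_quotient_le hd E) (sum_vonMangoldt_minFac_le hd E)).trans ?_
  rw [← sub_nonneg]
  have : 1 / (d * log d) - (1 / (d * (log d + log 2 / 2)) + 1 / (4 * (d * (d - 1)) * log d)) =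
      (2 * log 2 * (d - 1) - (log d + log 2 / 2)) /
        (4 * d * (d - 1) * log d * (log d + log 2 / 2)) := by
    field_simp
    ring
  rw [this]
  exact div_nonneg (by linarith) (by positivity)

lemma sum_primitive_le_sum_prime_divisors (A : Finset ℕ) (hA : ∀ a ∈ A, 2 ≤ a)
    (hprim : ∀ a ∈ A, ∀ b ∈ A, a ≠ b → ¬ a ∣ b) :
    ∑ a ∈ A, 1 / (a * log a) ≤
      ∑ p ∈ (A.biUnion Nat.divisors).erase 1 with p.Prime, 1 / (p * log p) := by
  set E := (A.biUnion Nat.divisors).erase 1 with hE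
  have hmemE (n : ℕ) : n ∈ E ↔ n ≠ 1 ∧ ∃ a ∈ A, n ∣ a := by
    rw [hE, mem_erase, mem_biUnion]
    refine and_congr_right fun _ ↦ exists_congr fun a ↦ and_congr_right fun ha ↦ ?_
    have := hA a ha
    rw [Nat.mem_divisors, and_iff_left (by omega)]
  have htwo (n : ℕ) (hn : n ∈ E) : 2 ≤ n := by
    obtain ⟨h1, a, ha, hna⟩ := (hmemE n).1 hn
    have := Nat.pos_of_dvd_of_pos hna (by have := hA a ha; omega)
    omega
  have hAE : A ⊆ E := fun a ha ↦ (hmemE a).2 ⟨by have := hA a ha; omega, a, ha, dvd_rfl⟩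
  have hinflow (n : ℕ) (hn : n ∈ E) : 1 / (n * log n) ≤
      (if n.Prime then 1 / (n * log n) else 0) +
        ∑ d ∈ E \ A, if d ∣ n ∧ d < n then edgeFlow d n else 0 := by
    split_ifs with hp
    · refine le_add_of_nonneg_right (sum_nonneg fun d _ ↦ ?_)
      split_ifs
      exacts [edgeFlow_nonneg d n, le_rfl]
    · rw [zero_add, ← sum_filter, ← sum_edgeFlow_properDivisors (htwo n hn) hp]
      refine sum_le_sum_of_subset_of_nonneg (fun d hd ↦ ?_) fun d _ _ ↦ edgeFlow_nonneg d n
      rw [mem_erase, Nat.mem_properDivisors] at hd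
      obtain ⟨hd1, hdn, hlt⟩ := hd
      obtain ⟨-, a, ha, hna⟩ := (hmemE n).1 hn
      refine mem_filter.2 ⟨mem_sdiff.2 ⟨(hmemE d).2 ⟨hd1, a, ha, hdn.trans hna⟩, fun hdA ↦ ?_⟩,
        hdn, hlt⟩
      refine hprim d hdA a ha ?_ (hdn.trans hna)
      have := Nat.le_of_dvd (by have := hA a ha; omega) hna
      omega
  have htotal : ∑ n ∈ E, 1 / (n * log n) ≤
      ∑ p ∈ E with p.Prime, 1 / (p * log p) + ∑ d ∈ E \ A, 1 / (d * log d) := by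
    refine (sum_le_sum hinflow).trans ?_
    rw [sum_add_distrib, ← sum_filter, sum_comm]
    refine add_le_add le_rfl (sum_le_sum fun d hd ↦ ?_)
    rw [← sum_filter]
    exact sum_edgeFlow_le (htwo d (mem_sdiff.1 hd).1) E
  rw [← sum_sdiff hAE] at htotal
  linarith

lemma summable_one_div_prime_mul_log :
    Summable fun p : {p : ℕ // p.Prime} ↦ 1 / (((p : ℕ) : ℝ) * log ((p : ℕ) : ℝ)) := by
  refine summable_of_sum_le (c := 4 * (1 / (log 2 + log 2 / 2))) (fun p ↦ by positivity) fun u ↦ ?_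
  have hl2 : 0 < log 2 := log_pos (by norm_num)
  refine le_trans ?_ (mul_le_mul_of_nonneg_left
    (sum_vonMangoldt_div_mul_sq_le hl2 (u.map (Function.Embedding.subtype _))) (by norm_num))
  rw [sum_map, mul_sum]
  refine sum_le_sum fun p _ ↦ ?_
  have hp := p.2.two_le
  have hp2 : (2 : ℝ) ≤ (p : ℕ) := by exact_mod_cast hp
  have hlog : log 2 ≤ log (p : ℕ) := log_le_log (by norm_num) hp2
  have hlog0 : 0 < log (p : ℕ) := hl2.trans_le hlog
  simp only [Function.Embedding.subtype_apply]
  rw [ArithmeticFunction.vonMangoldt_apply_prime p.2]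
  calc 1 / (((p : ℕ) : ℝ) * log (p : ℕ))
      = 4 * (log (p : ℕ) / ((p : ℕ) * (log (p : ℕ) + log (p : ℕ)) ^ 2)) := by
        field_simp
        norm_num
    _ ≤ _ := by gcongr

theorem erdos_primitive_set_conjecture (A : Set ℕ) (hA : Primitive A) (h1 : 1 ∉ A) :
    ∑' a : A, 1 / (((a : ℕ) : ℝ) * Real.log ((a : ℕ) : ℝ)) ≤
      ∑' p : {p : ℕ // p.Prime}, 1 / (((p : ℕ) : ℝ) * Real.log ((p : ℕ) : ℝ)) := by
  refine Real.tsum_le_of_sum_le (fun a ↦ by positivity) fun u ↦ ?_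
  set B := (u.map (Function.Embedding.subtype _)).erase 0 with hB
  have hBA (b : ℕ) (hb : b ∈ B) : b ≠ 0 ∧ b ∈ A := by
    rw [hB, mem_erase, mem_map] at hb
    obtain ⟨h0, a, -, rfl⟩ := hb
    exact ⟨h0, a.2⟩
  have hsum : ∑ a ∈ u, 1 / (((a : ℕ) : ℝ) * log ((a : ℕ) : ℝ)) = ∑ b ∈ B, 1 / (b * log b) := by
    rw [hB, sum_erase _ (by simp), sum_map]
    rfl
  rw [hsum]
  refine (sum_primitive_le_sum_prime_divisors B (fun b hb ↦ ?_) fun a ha b hb ↦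
    hA a (hBA a ha).2 b (hBA b hb).2).trans ?_
  · have hb1 : b ≠ 1 := fun h ↦ h1 (h ▸ (hBA b hb).2)
    have := (hBA b hb).1
    omega
  · rw [← sum_subtype_eq_sum_filter]
    exact summable_one_div_prime_mul_log.sum_le_tsum _ fun p _ ↦ by positivity
end

section
/- Let $k \geq 1$ and let $A$ be a primitive set contained in $\mathbb{N}_{\geq k} = \{n : \Omega(n) \geq k\}$. Then for any set $\mathcal{Q}$ of odd primes, $f(A(\mathcal{Q})) \leq f(\mathbb{N}_k(\mathcal{Q}))$, where $\mathbb{N}_k(\mathcal{Q})$ is the set of natural numbers $n$ with $\Omega(n) = k$ all of whose prime factors lie in $\mathcal{Q}$. -/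
/-- The members of `A` all of whose prime factors lie in `Q`. -/
def restrictPrimes (A : Set ℕ) (Q : Set ℕ) : Set ℕ :=
  {n | n ∈ A ∧ ∀ p : ℕ, p.Prime → p ∣ n → p ∈ Q}

/-- `f(A) = ∑_{a ∈ A} 1/(a log a)`. -/
noncomputable def fSet (A : Set ℕ) : ℝ :=
  ∑' a : A, 1 / (((a : ℕ) : ℝ) * Real.log ((a : ℕ) : ℝ))

lemma log_le_of_pow_le {n a b : ℕ} (hn : 0 < n) (ha : 0 < a) (h : n ^ a ≤ 2 ^ b) :
    Real.log n ≤ b / a * Real.log 2 := by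
  have h1 : Real.log ((n : ℝ) ^ a) ≤ Real.log ((2 : ℝ) ^ b) :=
    Real.log_le_log (by positivity) (by exact_mod_cast h)
  rw [Real.log_pow, Real.log_pow] at h1
  have ha' : (0 : ℝ) < a := by exact_mod_cast ha
  rw [div_mul_eq_mul_div, le_div_iff₀ ha']
  linarith

lemma log_three_bounds : 1.097 ≤ Real.log 3 ∧ Real.log 3 ≤ 1.101 := by
  constructor
  · have h1 : Real.log ((2 : ℝ) ^ 19) ≤ Real.log ((3 : ℝ) ^ 12) :=
      Real.log_le_log (by positivity) (by norm_num)
    rw [Real.log_pow, Real.log_pow] at h1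
    push_cast at h1
    linarith [Real.log_two_gt_d9]
  · have := log_le_of_pow_le (n := 3) (a := 17) (b := 27) (by norm_num) (by norm_num) (by norm_num)
    push_cast at this
    linarith [Real.log_two_lt_d9]

/-- A telescoping upper bound for `2 log n / (n (n - 2))` along a progression of step two. -/
lemma log_term_le_telescope {x : ℝ} (hx : 3 ≤ x) :
    2 * Real.log x / (x * (x - 2)) ≤
      (Real.log x + 1) / (x - 2) - (Real.log (x + 2) + 1) / (x + 2 - 2) := by
  have h1 : Real.log (x + 2) ≤ Real.log x + 2 / x := by
    have h2 : Real.log ((x + 2) / x) ≤ (x + 2) / x - 1 :=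
      Real.log_le_sub_one_of_pos (by positivity)
    rw [Real.log_div (by positivity) (by positivity)] at h2
    have : (x + 2) / x - 1 = 2 / x := by field_simp; ring
    linarith
  have hx0 : 0 < x := by linarith
  have hx2 : 0 < x - 2 := by linarith
  have h3 : (Real.log (x + 2) + 1) / (x + 2 - 2) ≤ (Real.log x + 2 / x + 1) / x := by
    rw [add_sub_cancel_right]
    gcongr
  have h4 : (Real.log x + 1) / (x - 2) - (Real.log x + 2 / x + 1) / x
      - 2 * Real.log x / (x * (x - 2)) = 4 / (x ^ 2 * (x - 2)) := by
    field_simp; ring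
  have : 0 ≤ 4 / (x ^ 2 * (x - 2)) := by positivity
  linarith

lemma sum_log_term_tail (J : ℕ) :
    ∑ j ∈ Finset.range J, 2 * Real.log ((37 + 2 * j : ℕ) : ℝ) /
      (((37 + 2 * j : ℕ) : ℝ) * (((37 + 2 * j : ℕ) : ℝ) - 2)) ≤
      (Real.log 37 + 1) / 35 - (Real.log ((37 + 2 * J : ℕ) : ℝ) + 1) /
        (((37 + 2 * J : ℕ) : ℝ) - 2) := by
  induction J with
  | zero => norm_num
  | succ J ih =>
    rw [Finset.sum_range_succ]
    have := log_term_le_telescope (x := ((37 + 2 * J : ℕ) : ℝ)) (by push_cast; linarith [J.cast_nonneg (α := ℝ)])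
    have e : ((37 + 2 * (J + 1) : ℕ) : ℝ) = ((37 + 2 * J : ℕ) : ℝ) + 2 := by push_cast; ring
    rw [e]
    linarith

lemma log_term_nonneg {p : ℕ} (hp : 3 ≤ p) :
    0 ≤ 2 * Real.log (p : ℝ) / ((p : ℝ) * ((p : ℝ) - 2)) := by
  have h : (3 : ℝ) ≤ p := by exact_mod_cast hp
  have := Real.log_nonneg (by linarith : (1 : ℝ) ≤ p)
  have h2 : (0 : ℝ) ≤ p - 2 := by linarith
  positivity

lemma sum_log_term_le (T : Finset ℕ) (hT : ∀ p ∈ T, p.Prime ∧ 5 ≤ p) :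
    ∑ p ∈ T, 2 * Real.log (p : ℝ) / ((p : ℝ) * ((p : ℝ) - 2)) ≤ 0.62 := by
  rw [← Finset.sum_filter_add_sum_filter_not T (fun p => p < 37)]
  have h1 : ∑ p ∈ T with p < 37, 2 * Real.log (p : ℝ) / ((p : ℝ) * ((p : ℝ) - 2)) ≤ 0.484 := by
    have hsub : (T.filter fun p => p < 37) ⊆ ({5, 7, 11, 13, 17, 19, 23, 29, 31} : Finset ℕ) := by
      intro p hp
      rw [Finset.mem_filter] at hp
      obtain ⟨hpT, hlt⟩ := hp
      obtain ⟨hpp, h5⟩ := hT p hpT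
      interval_cases p <;> first | decide | (exfalso; revert hpp; norm_num)
    refine (Finset.sum_le_sum_of_subset_of_nonneg hsub ?_).trans ?_
    · intro p hp _
      refine log_term_nonneg ?_
      simp only [Finset.mem_insert, Finset.mem_singleton] at hp
      omega
    · have l5 := log_le_of_pow_le (n := 5) (a := 3) (b := 7) (by norm_num) (by norm_num) (by norm_num)
      have l7 := log_le_of_pow_le (n := 7) (a := 6) (b := 17) (by norm_num) (by norm_num) (by norm_num)
      have l11 := log_le_of_pow_le (n := 11) (a := 2) (b := 7) (by norm_num) (by norm_num) (by norm_num)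
      have l13 := log_le_of_pow_le (n := 13) (a := 4) (b := 15) (by norm_num) (by norm_num) (by norm_num)
      have l17 := log_le_of_pow_le (n := 17) (a := 8) (b := 33) (by norm_num) (by norm_num) (by norm_num)
      have l19 := log_le_of_pow_le (n := 19) (a := 4) (b := 17) (by norm_num) (by norm_num) (by norm_num)
      have l23 := log_le_of_pow_le (n := 23) (a := 5) (b := 23) (by norm_num) (by norm_num) (by norm_num)
      have l29 := log_le_of_pow_le (n := 29) (a := 1) (b := 5) (by norm_num) (by norm_num) (by norm_num)
      have l31 := log_le_of_pow_le (n := 31) (a := 1) (b := 5) (by norm_num) (by norm_num) (by norm_num)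
      have := Real.log_two_lt_d9
      push_cast at l5 l7 l11 l13 l17 l19 l23 l29 l31
      iterate 8 rw [Finset.sum_insert (by decide)]
      rw [Finset.sum_singleton]
      norm_num
      linarith
  have h2 : ∑ p ∈ T with ¬ p < 37, 2 * Real.log (p : ℝ) / ((p : ℝ) * ((p : ℝ) - 2)) ≤ 0.133 := by
    set T' := T.filter fun p => ¬ p < 37 with hT'
    have hsub : T' ⊆ (Finset.range (T'.sup id)).image (fun j => 37 + 2 * j) := by
      intro p hp
      have hle : p ≤ T'.sup id := Finset.le_sup (f := id) hp
      rw [hT', Finset.mem_filter] at hp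
      obtain ⟨hpp, h5⟩ := hT p hp.1
      have hodd : p % 2 = 1 := hpp.eq_two_or_odd.resolve_left (by omega)
      rw [Finset.mem_image]
      exact ⟨(p - 37) / 2, by rw [Finset.mem_range]; omega, by omega⟩
    refine (Finset.sum_le_sum_of_subset_of_nonneg hsub ?_).trans ?_
    · intro p hp _
      rw [Finset.mem_image] at hp
      obtain ⟨j, -, rfl⟩ := hp
      exact log_term_nonneg (by omega)
    · rw [Finset.sum_image (by intro a _ b _ h; simpa using h)]
      refine (sum_log_term_tail _).trans ?_
      have l37 := log_le_of_pow_le (n := 37) (a := 4) (b := 21) (by norm_num) (by norm_num) (by norm_num)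
      have := Real.log_two_lt_d9
      set N := 37 + 2 * T'.sup id with hN
      have hN3 : (3 : ℝ) ≤ N := by exact_mod_cast (by omega : 3 ≤ N)
      have h0 : 0 ≤ (Real.log (N : ℝ) + 1) / ((N : ℝ) - 2) := by
        have := Real.log_nonneg (by linarith : (1 : ℝ) ≤ N)
        have h2 : (0 : ℝ) ≤ N - 2 := by linarith
        positivity
      push_cast at l37
      linarith
  linarith

/-- The numerical inequality behind the bound for the prime sum, in the variables
`u = 3 ^ (-s)` and `q = s * u`. -/
lemma numeric_bound {u q : ℝ} (hu0 : 0 < u) (hu1 : u ≤ 1)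
    (hq0 : 0 ≤ q) (hq : q * Real.log 3 ≤ (1 - u ^ 2) / 2) :
    (Real.log 3 * (2 - u) / (3 - u) + 0.62) * (2 * q + u ^ 2 + u * q / 3)
      + u * (Real.log 3 - 1 / 3) + 2 / 3 * Real.log 3 * q ≤ 2 := by
  obtain ⟨hl1, hl2⟩ := log_three_bounds
  have hq' : q ≤ 0.4558 * (1 - u ^ 2) := by nlinarith
  have hA : Real.log 3 * (2 - u) / (3 - u) ≤ 1.101 * (0.75 - 0.25 * u) := by
    rw [div_le_iff₀ (by linarith)]
    have : Real.log 3 * (2 - u) ≤ 1.101 * (2 - u) :=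
      mul_le_mul_of_nonneg_right hl2 (by linarith)
    nlinarith [sq_nonneg (1 - u)]
  have h1 : (Real.log 3 * (2 - u) / (3 - u) + 0.62) * (2 * q + u ^ 2 + u * q / 3) ≤
      (1.101 * (0.75 - 0.25 * u) + 0.62) * (2 * (0.4558 * (1 - u ^ 2)) + u ^ 2
        + u * (0.4558 * (1 - u ^ 2)) / 3) := by
    gcongr
    nlinarith
  have h2 : u * (Real.log 3 - 1 / 3) ≤ u * 0.7677 := by
    apply mul_le_mul_of_nonneg_left _ hu0.le; linarith
  have h3 : 2 / 3 * Real.log 3 * q ≤ 0.7341 * (0.4558 * (1 - u ^ 2)) := by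
    gcongr; linarith
  have h4 : (1.101 * (0.75 - 0.25 * u) + 0.62) * (2 * (0.4558 * (1 - u ^ 2)) + u ^ 2
        + u * (0.4558 * (1 - u ^ 2)) / 3) + u * 0.7677 + 0.7341 * (0.4558 * (1 - u ^ 2)) ≤ 2 := by
    nlinarith [sq_nonneg (u - 0.77), mul_nonneg hu0.le (sq_nonneg (u - 0.77)), mul_nonneg hu0.le (sub_nonneg.2 hu1), sq_nonneg (u^2 - 0.6), mul_nonneg (sub_nonneg.2 hu1) (sq_nonneg (u-0.77))]
  linarith

/-- The trapezoidal rule overestimates the integral of the convex function `x ^ (-1 - s)`. -/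
lemma rpow_neg_sub_le_trapezoid {s x y : ℝ} (hs : 0 < s) (hx : 0 < x) (hxy : x ≤ y) :
    x ^ (-s) - y ^ (-s) ≤ s * (y - x) / 2 * (x ^ (-1 - s) + y ^ (-1 - s)) := by
  have hder : ∀ t, 0 < t → HasDerivAt
      (fun t : ℝ => s * (t - x) / 2 * (x ^ (-1 - s) + t ^ (-1 - s)) + t ^ (-s))
      (s / 2 * (x ^ (-1 - s) + t ^ (-1 - s)) + s * (t - x) / 2 * ((-1 - s) * t ^ (-1 - s - 1))
        + -s * t ^ (-s - 1)) t := by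
    intro t ht
    have h1 : HasDerivAt (fun t : ℝ => s * (t - x) / 2) (s / 2) t := by
      have := (((hasDerivAt_id t).sub_const x).const_mul s).div_const 2
      simpa using this
    have h2 : HasDerivAt (fun t : ℝ => x ^ (-1 - s) + t ^ (-1 - s))
        ((-1 - s) * t ^ (-1 - s - 1)) t :=
      (Real.hasDerivAt_rpow_const (Or.inl ht.ne')).const_add _
    exact (h1.mul h2).add (Real.hasDerivAt_rpow_const (Or.inl ht.ne'))
  have hmono : MonotoneOn
      (fun t : ℝ => s * (t - x) / 2 * (x ^ (-1 - s) + t ^ (-1 - s)) + t ^ (-s)) (Set.Ici x) := by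
    refine monotoneOn_of_deriv_nonneg (convex_Ici x) ?_ ?_ ?_
    · intro t ht
      exact (hder t (hx.trans_le ht)).continuousAt.continuousWithinAt
    · intro t ht
      rw [interior_Ici] at ht
      exact (hder t (hx.trans ht)).differentiableAt.differentiableWithinAt
    · intro t ht
      rw [interior_Ici] at ht
      have ht0 : 0 < t := hx.trans ht
      rw [(hder t ht0).deriv]
      have e1 : t ^ (-s - 1) = t ^ (-1 - s) := by congr 1; ring
      have e2 : t ^ (-1 - s - 1) = t ^ (-1 - s) / t := by
        rw [Real.rpow_sub_one ht0.ne']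
      have e3 : x ^ (-1 - s) = t ^ (-1 - s) * (x / t) ^ (-1 - s) := by
        rw [← Real.mul_rpow ht0.le (by positivity)]
        congr 1; field_simp
      have e4 : 1 + (-1 - s) * (x / t - 1) ≤ (x / t) ^ (-1 - s) := by
        have hxt : 0 < x / t := by positivity
        rw [Real.rpow_def_of_pos hxt]
        have := Real.add_one_le_exp (Real.log (x / t) * (-1 - s))
        have h5 := Real.log_le_sub_one_of_pos hxt
        nlinarith
      have hpos : 0 < t ^ (-1 - s) := Real.rpow_pos_of_pos ht0 _
      rw [e1, e2, e3]
      have : s / 2 * (t ^ (-1 - s) * (x / t) ^ (-1 - s) + t ^ (-1 - s)) +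
          s * (t - x) / 2 * ((-1 - s) * (t ^ (-1 - s) / t)) + -s * t ^ (-1 - s) =
          s / 2 * t ^ (-1 - s) * ((x / t) ^ (-1 - s) - (1 + (-1 - s) * (x / t - 1))) := by
        field_simp; ring
      rw [this]
      have : 0 ≤ (x / t) ^ (-1 - s) - (1 + (-1 - s) * (x / t - 1)) := by linarith
      positivity
  have := hmono (Set.self_mem_Ici) hxy hxy
  simp only [sub_self, mul_zero, zero_div, zero_mul, zero_add] at this
  linarith

lemma summable_odd_rpow {s : ℝ} (hs : 0 < s) :
    Summable fun k : ℕ => ((2 * k + 1 : ℕ) : ℝ) ^ (-1 - s) := by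
  have h := (Real.summable_nat_rpow_inv (p := 1 + s)).2 (by linarith)
  have h2 := h.comp_injective (i := fun k : ℕ => 2 * k + 1) (by intro a b hab; simpa using hab)
  refine h2.congr fun k => ?_
  simp only [Function.comp]
  rw [← Real.rpow_neg (by positivity)]
  congr 1; ring

lemma three_rpow (s : ℝ) : (3 : ℝ) ^ (-1 - s) = 3 ^ (-s) / 3 := by
  rw [← Real.rpow_sub_one (by norm_num)]; congr 1; ring

lemma le_sum_odd_rpow {s : ℝ} (hs : 0 < s) (n : ℕ) :
    1 + (3 : ℝ) ^ (-s) / 6 + ((3 : ℝ) ^ (-s) - ((2 * n + 3 : ℕ) : ℝ) ^ (-s)) / (2 * s)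
      + ((2 * n + 3 : ℕ) : ℝ) ^ (-1 - s) / 2 ≤
    ∑ k ∈ Finset.range (n + 2), ((2 * k + 1 : ℕ) : ℝ) ^ (-1 - s) := by
  induction n with
  | zero =>
    simp [Finset.sum_range_succ]
    norm_num
    rw [three_rpow]
    linarith
  | succ n ih =>
    rw [Finset.sum_range_succ]
    have h := rpow_neg_sub_le_trapezoid hs (x := ((2 * n + 3 : ℕ) : ℝ))
      (y := ((2 * (n + 1) + 3 : ℕ) : ℝ)) (by positivity) (by norm_cast; omega)
    have e : 2 * (n + 2) + 1 = 2 * (n + 1) + 3 := by ring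
    rw [e]
    have e2 : ((2 * (n + 1) + 3 : ℕ) : ℝ) - ((2 * n + 3 : ℕ) : ℝ) = 2 := by push_cast; ring
    rw [e2] at h
    set A := ((2 * n + 3 : ℕ) : ℝ) ^ (-s)
    set B := ((2 * (n + 1) + 3 : ℕ) : ℝ) ^ (-s)
    set a := ((2 * n + 3 : ℕ) : ℝ) ^ (-1 - s)
    set b := ((2 * (n + 1) + 3 : ℕ) : ℝ) ^ (-1 - s)
    have h3 : (A - B) / (2 * s) ≤ (a + b) / 2 := by
      rw [div_le_iff₀ (by positivity)]
      nlinarith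
    have h4 : ((3 : ℝ) ^ (-s) - B) / (2 * s) =
      ((3 : ℝ) ^ (-s) - A) / (2 * s) + (A - B) / (2 * s) := by ring
    linarith

lemma le_tsum_odd_rpow {s : ℝ} (hs : 0 < s) :
    1 + (3 : ℝ) ^ (-s) / 6 + (3 : ℝ) ^ (-s) / (2 * s) ≤
      ∑' k : ℕ, ((2 * k + 1 : ℕ) : ℝ) ^ (-1 - s) := by
  have hlim : Filter.Tendsto (fun n : ℕ => ((2 * n + 3 : ℕ) : ℝ) ^ (-s)) Filter.atTop (nhds 0) := by
    refine (tendsto_rpow_neg_atTop hs).comp (tendsto_natCast_atTop_atTop.comp ?_)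
    exact Filter.tendsto_atTop_mono (fun n => by simp only [id]; omega) Filter.tendsto_id
  have hlim2 : Filter.Tendsto (fun n : ℕ => 1 + (3 : ℝ) ^ (-s) / 6 +
      ((3 : ℝ) ^ (-s) - ((2 * n + 3 : ℕ) : ℝ) ^ (-s)) / (2 * s)) Filter.atTop
      (nhds (1 + (3 : ℝ) ^ (-s) / 6 + ((3 : ℝ) ^ (-s) - 0) / (2 * s))) :=
    ((hlim.const_sub _).div_const _).const_add _
  rw [sub_zero] at hlim2
  refine le_of_tendsto' hlim2 fun n => ?_
  have h1 := le_sum_odd_rpow hs n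
  have h2 := (summable_odd_rpow hs).sum_le_tsum (Finset.range (n + 2))
    (fun k _ => Real.rpow_nonneg (by positivity) _)
  have h3 : 0 ≤ ((2 * n + 3 : ℕ) : ℝ) ^ (-1 - s) := Real.rpow_nonneg (by positivity) _
  linarith

lemma log_mul_rpow_le_telescope {s x : ℝ} (hs : 0 < s) (hx : 3 ≤ x) :
    Real.log (x + 2) * (x + 2) ^ (-1 - s) ≤
      x ^ (-s) * (Real.log x / (2 * s) + 1 / (2 * s ^ 2)) -
      (x + 2) ^ (-s) * (Real.log (x + 2) / (2 * s) + 1 / (2 * s ^ 2)) := by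
  set K : ℝ → ℝ := fun t => t ^ (-s) * (Real.log t / (2 * s) + 1 / (2 * s ^ 2)) with hK
  have hder : ∀ t, 0 < t → HasDerivAt K (-(Real.log t * t ^ (-1 - s)) / 2) t := by
    intro t ht
    have h1 : HasDerivAt (fun t : ℝ => t ^ (-s)) (-s * t ^ (-s - 1)) t :=
      Real.hasDerivAt_rpow_const (Or.inl ht.ne')
    have h2 : HasDerivAt (fun t : ℝ => Real.log t / (2 * s) + 1 / (2 * s ^ 2))
        (t⁻¹ / (2 * s)) t := ((Real.hasDerivAt_log ht.ne').div_const _).add_const _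
    refine (h1.mul h2).congr_deriv ?_
    have e : t ^ (-s - 1) = t ^ (-1 - s) := by congr 1; ring
    have e1 : t ^ (-s) = t ^ (-1 - s) * t := by
      rw [← Real.rpow_add_one ht.ne']; congr 1; ring
    rw [e, e1]
    field_simp
    ring
  obtain ⟨c, ⟨hc1, hc2⟩, hc⟩ := exists_hasDerivAt_eq_slope K
    (fun t => -(Real.log t * t ^ (-1 - s)) / 2) (a := x) (b := x + 2) (by linarith)
    (fun t ht => (hder t (by linarith [ht.1])).continuousAt.continuousWithinAt)
    (fun t ht => hder t (by linarith [ht.1]))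
  have hanti := Real.log_div_self_rpow_antitoneOn (a := 1 + s) (by linarith)
  have hexp : Real.exp (1 + s)⁻¹ ≤ 3 := by
    have : Real.exp (1 + s)⁻¹ ≤ Real.exp 1 :=
      Real.exp_le_exp.2 (inv_le_one_of_one_le₀ (by linarith))
    linarith [Real.exp_one_lt_d9]
  have h := hanti (a := c) (b := x + 2) (by simp only [Set.mem_Ici]; linarith)
    (by simp only [Set.mem_Ici]; linarith) hc2.le
  have e : ∀ t : ℝ, 0 < t → Real.log t / t ^ (1 + s) = Real.log t * t ^ (-1 - s) := by
    intro t ht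
    rw [div_eq_mul_inv, ← Real.rpow_neg ht.le]
    congr 2; ring
  simp only at h
  rw [e _ (by linarith), e _ (by linarith)] at h
  have h5 : (K (x + 2) - K x) / (x + 2 - x) = (K (x + 2) - K x) / 2 := by ring
  rw [h5] at hc
  change _ ≤ K x - K (x + 2)
  linarith

lemma sum_odd_log_rpow_le {s : ℝ} (hs : 0 < s) (n : ℕ) :
    ∑ k ∈ Finset.range n, Real.log ((2 * k + 1 : ℕ) : ℝ) * ((2 * k + 1 : ℕ) : ℝ) ^ (-1 - s) ≤
      (3 : ℝ) ^ (-s) * (Real.log 3 / 3 + Real.log 3 / (2 * s) + 1 / (2 * s ^ 2)) := by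
  have key : ∀ n : ℕ, ∑ k ∈ Finset.range (n + 2),
      Real.log ((2 * k + 1 : ℕ) : ℝ) * ((2 * k + 1 : ℕ) : ℝ) ^ (-1 - s) ≤
      (3 : ℝ) ^ (-s) * (Real.log 3 / 3 + Real.log 3 / (2 * s) + 1 / (2 * s ^ 2)) -
      ((2 * n + 3 : ℕ) : ℝ) ^ (-s) *
        (Real.log ((2 * n + 3 : ℕ) : ℝ) / (2 * s) + 1 / (2 * s ^ 2)) := by
    intro n
    induction n with
    | zero =>
      simp [Finset.sum_range_succ]
      norm_num
      rw [three_rpow]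
      apply le_of_eq
      ring
    | succ n ih =>
      rw [Finset.sum_range_succ]
      have h := log_mul_rpow_le_telescope hs (x := ((2 * n + 3 : ℕ) : ℝ))
        (by push_cast; linarith [n.cast_nonneg (α := ℝ)])
      have e : 2 * (n + 2) + 1 = 2 * (n + 1) + 3 := by ring
      have e2 : ((2 * n + 3 : ℕ) : ℝ) + 2 = ((2 * (n + 1) + 3 : ℕ) : ℝ) := by push_cast; ring
      rw [e2] at h
      rw [e]
      linarith
  have hnn : ∀ k : ℕ, 0 ≤ Real.log ((2 * k + 1 : ℕ) : ℝ) * ((2 * k + 1 : ℕ) : ℝ) ^ (-1 - s) :=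
    fun k => mul_nonneg (Real.log_natCast_nonneg _) (Real.rpow_nonneg (by positivity) _)
  refine (Finset.sum_le_sum_of_subset_of_nonneg
    (Finset.range_mono (by omega : n ≤ n + 2)) (fun k _ _ => hnn k)).trans ((key n).trans ?_)
  have : 0 ≤ ((2 * n + 3 : ℕ) : ℝ) ^ (-s) *
        (Real.log ((2 * n + 3 : ℕ) : ℝ) / (2 * s) + 1 / (2 * s ^ 2)) := by
    have := Real.log_natCast_nonneg (2 * n + 3)
    have := Real.rpow_nonneg (Nat.cast_nonneg (α := ℝ) (2 * n + 3)) (-s)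
    positivity
  linarith

lemma summable_odd_log_rpow {s : ℝ} (hs : 0 < s) :
    Summable fun k : ℕ => Real.log ((2 * k + 1 : ℕ) : ℝ) * ((2 * k + 1 : ℕ) : ℝ) ^ (-1 - s) :=
  summable_of_sum_range_le
    (fun k => mul_nonneg (Real.log_natCast_nonneg _) (Real.rpow_nonneg (by positivity) _))
    (sum_odd_log_rpow_le hs)

lemma tsum_odd_log_rpow_le {s : ℝ} (hs : 0 < s) :
    ∑' k : ℕ, Real.log ((2 * k + 1 : ℕ) : ℝ) * ((2 * k + 1 : ℕ) : ℝ) ^ (-1 - s) ≤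
      (3 : ℝ) ^ (-s) * (Real.log 3 / 3 + Real.log 3 / (2 * s) + 1 / (2 * s ^ 2)) :=
  Real.tsum_le_of_sum_range_le
    (fun k => mul_nonneg (Real.log_natCast_nonneg _) (Real.rpow_nonneg (by positivity) _))
    (sum_odd_log_rpow_le hs)

lemma sum_factorization_mul_log_le {n : ℕ} (T : Finset ℕ) :
    ∑ p ∈ T, (n.factorization p : ℝ) * Real.log p ≤ Real.log n := by
  rw [Real.log_nat_eq_sum_factorization, Finsupp.sum]
  have h1 : ∑ p ∈ T, (n.factorization p : ℝ) * Real.log p =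
      ∑ p ∈ T with p ∈ n.factorization.support, (n.factorization p : ℝ) * Real.log p := by
    rw [Finset.sum_filter]
    refine Finset.sum_congr rfl fun p _ => ?_
    split_ifs with h
    · rfl
    · rw [Finsupp.notMem_support_iff.1 h]; simp
  rw [h1]
  refine Finset.sum_le_sum_of_subset_of_nonneg (fun p hp => (Finset.mem_filter.1 hp).2) ?_
  intro p _ _
  exact mul_nonneg (Nat.cast_nonneg _) (Real.log_natCast_nonneg _)

lemma summable_odd_factorization_rpow {s : ℝ} (hs : 0 < s) {p : ℕ} (hp : p.Prime) :
    Summable fun k : ℕ => ((2 * k + 1).factorization p : ℝ) * ((2 * k + 1 : ℕ) : ℝ) ^ (-1 - s) := by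
  have hl : 0 < Real.log p := Real.log_pos (by exact_mod_cast hp.one_lt)
  refine Summable.of_nonneg_of_le (fun k => by positivity) (fun k => ?_)
    ((summable_odd_log_rpow hs).mul_left (Real.log p)⁻¹)
  have h := sum_factorization_mul_log_le (n := 2 * k + 1) {p}
  rw [Finset.sum_singleton] at h
  rw [← mul_assoc]
  refine mul_le_mul_of_nonneg_right ?_ (by positivity)
  rw [inv_mul_eq_div, le_div_iff₀ hl]
  exact h

lemma tsum_odd_factorization_rpow {s : ℝ} (hs : 0 < s) {p : ℕ} (hp : p.Prime)
    (hp2 : p ≠ 2) :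
    ∑' k : ℕ, ((2 * k + 1).factorization p : ℝ) * ((2 * k + 1 : ℕ) : ℝ) ^ (-1 - s) =
      (p : ℝ) ^ (-s) / (p - (p : ℝ) ^ (-s)) * ∑' k : ℕ, ((2 * k + 1 : ℕ) : ℝ) ^ (-1 - s) := by
  set X := ∑' k : ℕ, ((2 * k + 1).factorization p : ℝ) * ((2 * k + 1 : ℕ) : ℝ) ^ (-1 - s) with hX
  set Z := ∑' k : ℕ, ((2 * k + 1 : ℕ) : ℝ) ^ (-1 - s) with hZ
  obtain ⟨r, hr⟩ := hp.odd_of_ne_two hp2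
  have hinj : Function.Injective fun m : ℕ => p * m + r := by
    intro a b hab
    exact Nat.eq_of_mul_eq_mul_left hp.pos (by simpa using hab)
  have hmul : ∀ m, 2 * (p * m + r) + 1 = p * (2 * m + 1) := by intro m; rw [hr]; ring
  have hp0 : (0 : ℝ) < p := by exact_mod_cast hp.pos
  have hrec : X = (p : ℝ) ^ (-s) / p * (X + Z) := by
    conv_lhs => rw [hX]
    rw [← hinj.tsum_eq, hX, hZ,
      ← (summable_odd_factorization_rpow hs hp).tsum_add (summable_odd_rpow hs), ← tsum_mul_left]
    · refine tsum_congr fun m => ?_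
      simp only [hmul]
      rw [Nat.factorization_mul hp.ne_zero (by omega), Finsupp.add_apply,
        hp.factorization_self, Nat.cast_mul, Real.mul_rpow hp0.le (by positivity),
        ← Real.rpow_sub_one hp0.ne']
      have : (p : ℝ) ^ (-1 - s) = (p : ℝ) ^ (-s - 1) := by congr 1; ring
      rw [this]
      push_cast
      ring
    · intro k hk
      have hne : (2 * k + 1).factorization p ≠ 0 := by
        intro h
        apply hk
        simp [h]
      have hdvd : p ∣ 2 * k + 1 := Nat.dvd_of_factorization_pos hne
      obtain ⟨c, hc⟩ := hdvd
      have hcodd : c % 2 = 1 := by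
        have : (p * c) % 2 = 1 := by omega
        rw [Nat.mul_mod] at this
        rcases Nat.mod_two_eq_zero_or_one c with h | h
        · rw [h] at this; simp at this
        · exact h
      refine ⟨c / 2, ?_⟩
      have h1 := hmul (c / 2)
      have h2 : 2 * (c / 2) + 1 = c := by omega
      rw [h2, ← hc] at h1
      simp only
      omega
  have hu1 : (p : ℝ) ^ (-s) < p := by
    have h1 : (1 : ℝ) < p := by exact_mod_cast hp.one_lt
    exact (Real.rpow_le_one_of_one_le_of_nonpos h1.le (by linarith)).trans_lt h1
  rw [div_mul_eq_mul_div, eq_div_iff (by linarith)]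
  field_simp at hrec
  linarith

lemma sum_log_mul_tsum_le {s : ℝ} (hs : 0 < s) (T : Finset ℕ)
    (hT : ∀ p ∈ T, p.Prime ∧ p ≠ 2) :
    (∑ p ∈ T, Real.log p * ((p : ℝ) ^ (-s) / (p - (p : ℝ) ^ (-s)))) *
      ∑' k : ℕ, ((2 * k + 1 : ℕ) : ℝ) ^ (-1 - s) ≤
    ∑' k : ℕ, Real.log ((2 * k + 1 : ℕ) : ℝ) * ((2 * k + 1 : ℕ) : ℝ) ^ (-1 - s) := by
  have hsum : ∀ p ∈ T, Summable fun k : ℕ =>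
      Real.log p * (((2 * k + 1).factorization p : ℝ) * ((2 * k + 1 : ℕ) : ℝ) ^ (-1 - s)) :=
    fun p hp => (summable_odd_factorization_rpow hs (hT p hp).1).mul_left _
  have h1 : (∑ p ∈ T, Real.log p * ((p : ℝ) ^ (-s) / (p - (p : ℝ) ^ (-s)))) *
      ∑' k : ℕ, ((2 * k + 1 : ℕ) : ℝ) ^ (-1 - s) =
      ∑' k : ℕ, ∑ p ∈ T, Real.log p *
        (((2 * k + 1).factorization p : ℝ) * ((2 * k + 1 : ℕ) : ℝ) ^ (-1 - s)) := by
    rw [Summable.tsum_finsetSum hsum, Finset.sum_mul]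
    refine Finset.sum_congr rfl fun p hp => ?_
    rw [tsum_mul_left, tsum_odd_factorization_rpow hs (hT p hp).1 (hT p hp).2, mul_assoc]
  rw [h1]
  refine Summable.tsum_le_tsum (fun k => ?_) (summable_sum hsum) (summable_odd_log_rpow hs)
  have h2 := sum_factorization_mul_log_le (n := 2 * k + 1) T
  have h3 : (0 : ℝ) ≤ ((2 * k + 1 : ℕ) : ℝ) ^ (-1 - s) := by positivity
  calc _ = (∑ p ∈ T, ((2 * k + 1).factorization p : ℝ) * Real.log p) *
        ((2 * k + 1 : ℕ) : ℝ) ^ (-1 - s) := by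
        rw [Finset.sum_mul]; exact Finset.sum_congr rfl fun p _ => by ring
    _ ≤ _ := mul_le_mul_of_nonneg_right h2 h3

lemma rpow_neg_three_bounds {s : ℝ} (hs : 0 < s) :
    s * (3 : ℝ) ^ (-s) * Real.log 3 ≤ (1 - ((3 : ℝ) ^ (-s)) ^ 2) / 2 := by
  have hl : 0 < Real.log 3 := Real.log_pos (by norm_num)
  set y := Real.log 3 * s with hy
  have hy0 : 0 ≤ y := by positivity
  have hu : (3 : ℝ) ^ (-s) = Real.exp (-y) := by
    rw [Real.rpow_def_of_pos (by norm_num), hy]; congr 1; ring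
  have h := Real.self_le_sinh_iff.2 hy0
  rw [Real.sinh_eq] at h
  have hm : Real.exp y * Real.exp (-y) = 1 := by rw [← Real.exp_add]; simp
  have hpos := Real.exp_pos (-y)
  rw [hu]
  have h2 : y * Real.exp (-y) ≤ (Real.exp y - Real.exp (-y)) / 2 * Real.exp (-y) :=
    mul_le_mul_of_nonneg_right h hpos.le
  have h3 : s * Real.exp (-y) * Real.log 3 = y * Real.exp (-y) := by rw [hy]; ring
  rw [h3]
  nlinarith

/-- `∑ log p / ((p - 2) p ^ s) ≤ 1 / s` over odd primes. -/
lemma sum_log_div_sub_two_rpow_le {s : ℝ} (hs : 0 < s) (T : Finset ℕ)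
    (hT : ∀ p ∈ T, p.Prime ∧ p ≠ 2) :
    s * ∑ p ∈ T, Real.log p / (p - 2) * (p : ℝ) ^ (-s) ≤ 1 := by
  have hp3 : ∀ p ∈ T, 3 ≤ p := fun p hp => by
    have := (hT p hp).1.two_le
    have := (hT p hp).2
    omega
  set u := (3 : ℝ) ^ (-s) with hu
  have hu0 : 0 < u := Real.rpow_pos_of_pos (by norm_num) _
  have hu1 : u ≤ 1 := Real.rpow_le_one_of_one_le_of_nonpos (by norm_num) (by linarith)
  have hl : 0 < Real.log 3 := Real.log_pos (by norm_num)
  have hdecomp : ∀ p ∈ T, Real.log p / (p - 2) * (p : ℝ) ^ (-s) ≤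
      Real.log p * ((p : ℝ) ^ (-s) / (p - (p : ℝ) ^ (-s))) +
      (if p = 3 then Real.log 3 * (2 - u) / (3 - u) * u
        else u * (2 * Real.log p / (p * (p - 2)))) := by
    intro p hp
    split_ifs with h
    · subst h
      push_cast
      rw [← hu]
      have : 3 - u ≠ 0 := by linarith
      apply le_of_eq
      field_simp
      ring
    · have hR : (3 : ℝ) ≤ p := by exact_mod_cast hp3 p hp
      have hlp := Real.log_nonneg (by linarith : (1 : ℝ) ≤ p)
      set v := (p : ℝ) ^ (-s) with hv
      have hv0 : 0 < v := Real.rpow_pos_of_pos (by linarith) _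
      have hvu : v ≤ u := Real.rpow_le_rpow_of_nonpos (by norm_num) hR (by linarith)
      have e1 : Real.log p / (p - 2) * v = Real.log p * (v / (p - v)) +
          Real.log p / (p - 2) * (v * ((2 - v) / (p - v))) := by
        have : (p : ℝ) - v ≠ 0 := by linarith
        have : (p : ℝ) - 2 ≠ 0 := by linarith
        field_simp
        ring
      have e2 : u * (2 * Real.log p / (p * (p - 2))) = Real.log p / (p - 2) * (u * (2 / p)) := by
        have : (p : ℝ) - 2 ≠ 0 := by linarith
        field_simp
      rw [e1, e2]
      have h3 : (2 - v) / (p - v) ≤ 2 / p := by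
        rw [div_le_div_iff₀ (by linarith) (by linarith)]
        nlinarith
      have h4 : 0 ≤ Real.log p / (p - 2) := div_nonneg hlp (by linarith)
      have h5 : 0 ≤ (2 - v) / (p - v) := div_nonneg (by linarith) (by linarith)
      gcongr
  have hcorr : ∑ p ∈ T, (if p = 3 then Real.log 3 * (2 - u) / (3 - u) * u
        else u * (2 * Real.log p / (p * (p - 2)))) ≤
      u * (Real.log 3 * (2 - u) / (3 - u) + 0.62) := by
    rw [Finset.sum_ite]
    have h1 : ∑ p ∈ T with p = 3, Real.log 3 * (2 - u) / (3 - u) * u ≤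
        Real.log 3 * (2 - u) / (3 - u) * u := by
      have hsub : (T.filter fun p => p = 3) ⊆ {3} := by
        intro p hp; simpa using (Finset.mem_filter.1 hp).2
      have hnn : 0 ≤ Real.log 3 * (2 - u) / (3 - u) * u :=
        mul_nonneg (div_nonneg (mul_nonneg hl.le (by linarith)) (by linarith)) hu0.le
      refine (Finset.sum_le_sum_of_subset_of_nonneg hsub fun _ _ _ => hnn).trans ?_
      rw [Finset.sum_singleton]
    have h2 := sum_log_term_le (T.filter fun p => ¬ p = 3) (by
      intro p hp
      rw [Finset.mem_filter] at hp
      have hpp := (hT p hp.1).1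
      have := hp3 p hp.1
      refine ⟨hpp, ?_⟩
      by_contra hlt
      have : p = 4 := by omega
      subst this
      revert hpp; norm_num)
    have h3 := mul_le_mul_of_nonneg_left h2 hu0.le
    rw [Finset.mul_sum] at h3
    linarith
  set Z := ∑' k : ℕ, ((2 * k + 1 : ℕ) : ℝ) ^ (-1 - s)
  have hZ : 1 + u / 6 + u / (2 * s) ≤ Z := le_tsum_odd_rpow hs
  have hZ0 : 0 < Z := lt_of_lt_of_le (by positivity) hZ
  set P := ∑ p ∈ T, Real.log p * ((p : ℝ) ^ (-s) / (p - (p : ℝ) ^ (-s))) with hP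
  have hPZ : P * Z ≤ u * (Real.log 3 / 3 + Real.log 3 / (2 * s) + 1 / (2 * s ^ 2)) :=
    (sum_log_mul_tsum_le hs T hT).trans (tsum_odd_log_rpow_le hs)
  have hP0 : 0 ≤ P := Finset.sum_nonneg fun p hp => by
    have hR : (3 : ℝ) ≤ p := by exact_mod_cast hp3 p hp
    have h1 : (p : ℝ) ^ (-s) ≤ 1 :=
      Real.rpow_le_one_of_one_le_of_nonpos (by linarith) (by linarith)
    have h2 : (0 : ℝ) < (p : ℝ) ^ (-s) := Real.rpow_pos_of_pos (by linarith) _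
    exact mul_nonneg (Real.log_natCast_nonneg _) (div_nonneg h2.le (by linarith))
  have hPM : P * (1 + u / 6 + u / (2 * s)) ≤
      u * (Real.log 3 / 3 + Real.log 3 / (2 * s) + 1 / (2 * s ^ 2)) :=
    (mul_le_mul_of_nonneg_left hZ hP0).trans hPZ
  have hmain : ∑ p ∈ T, Real.log p / (p - 2) * (p : ℝ) ^ (-s) ≤
      P + u * (Real.log 3 * (2 - u) / (3 - u) + 0.62) := by
    refine (Finset.sum_le_sum hdecomp).trans ?_
    rw [Finset.sum_add_distrib]
    linarith
  have hnum := numeric_bound (q := s * u) hu0 hu1 (by positivity) (rpow_neg_three_bounds hs)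
  set D := Real.log 3 * (2 - u) / (3 - u) + 0.62
  have hM : 0 < 2 * s + s * u / 3 + u := by positivity
  have hPM2 : s * P * (2 * s + s * u / 3 + u) ≤
      u * (2 * s ^ 2 * Real.log 3 / 3 + s * Real.log 3 + 1) := by
    have h := mul_le_mul_of_nonneg_left hPM (by positivity : 0 ≤ 2 * s ^ 2)
    have e1 : 2 * s ^ 2 * (P * (1 + u / 6 + u / (2 * s))) = s * P * (2 * s + s * u / 3 + u) := by
      field_simp; ring
    have e2 : 2 * s ^ 2 * (u * (Real.log 3 / 3 + Real.log 3 / (2 * s) + 1 / (2 * s ^ 2))) =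
        u * (2 * s ^ 2 * Real.log 3 / 3 + s * Real.log 3 + 1) := by field_simp
    rw [e1, e2] at h
    exact h
  have hfin : s * (P + u * D) * (2 * s + s * u / 3 + u) ≤ 1 * (2 * s + s * u / 3 + u) := by
    have h := mul_le_mul_of_nonneg_left hnum hs.le
    have e : s * (P + u * D) * (2 * s + s * u / 3 + u) =
      s * P * (2 * s + s * u / 3 + u) + s * (D * (2 * (s * u) + u ^ 2 + u * (s * u) / 3)) := by
      ring
    rw [e]
    nlinarith
  exact (mul_le_mul_of_nonneg_left hmain hs.le).trans (le_of_mul_le_mul_right hfin hM)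

lemma integral_mul_exp_neg_mul {a : ℝ} (ha : 0 < a) :
    ∫ t in Set.Ioi (0 : ℝ), t * Real.exp (-(a * t)) = 1 / a ^ 2 := by
  have h := Real.integral_rpow_mul_exp_neg_mul_Ioi (a := 2) (r := a) (by norm_num) ha
  rw [Real.Gamma_two, mul_one, Real.rpow_two, div_pow, one_pow] at h
  rw [← h]
  refine MeasureTheory.setIntegral_congr_fun measurableSet_Ioi fun t _ => ?_
  norm_num

lemma integrableOn_mul_exp_neg_mul {a : ℝ} (ha : 0 < a) :
    MeasureTheory.IntegrableOn (fun t => t * Real.exp (-(a * t))) (Set.Ioi (0 : ℝ)) := by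
  refine MeasureTheory.Integrable.of_integral_ne_zero ?_
  rw [integral_mul_exp_neg_mul ha]
  positivity

lemma integral_exp_neg_mul {a : ℝ} (ha : 0 < a) :
    ∫ t in Set.Ioi (0 : ℝ), Real.exp (-(a * t)) = 1 / a := by
  have h := Real.integral_rpow_mul_exp_neg_mul_Ioi (a := 1) (r := a) (by norm_num) ha
  rw [Real.Gamma_one, mul_one, Real.rpow_one] at h
  rw [← h]
  refine MeasureTheory.setIntegral_congr_fun measurableSet_Ioi fun t _ => ?_
  norm_num

lemma integrableOn_exp_neg_mul {a : ℝ} (ha : 0 < a) :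
    MeasureTheory.IntegrableOn (fun t => Real.exp (-(a * t))) (Set.Ioi (0 : ℝ)) := by
  refine MeasureTheory.Integrable.of_integral_ne_zero ?_
  rw [integral_exp_neg_mul ha]
  positivity

/-- `∑ log p / ((p - 2) (L + log p) ^ 2) ≤ 1 / L` over odd primes. -/
lemma sum_log_div_sub_two_sq_le {L : ℝ} (hL : 0 < L) (T : Finset ℕ)
    (hT : ∀ p ∈ T, p.Prime ∧ p ≠ 2) :
    ∑ p ∈ T, Real.log p / (p - 2) * (1 / (L + Real.log p) ^ 2) ≤ 1 / L := by
  have hpos : ∀ p : ℕ, 0 < L + Real.log p := fun p => by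
    linarith [Real.log_natCast_nonneg p]
  have hint : ∀ p ∈ T, MeasureTheory.IntegrableOn
      (fun t => Real.log p / (p - 2) * (t * Real.exp (-((L + Real.log p) * t))))
      (Set.Ioi (0 : ℝ)) := fun p _ => (integrableOn_mul_exp_neg_mul (hpos p)).const_mul _
  have h1 : ∑ p ∈ T, Real.log p / (p - 2) * (1 / (L + Real.log p) ^ 2) =
      ∫ t in Set.Ioi (0 : ℝ), ∑ p ∈ T,
        Real.log p / (p - 2) * (t * Real.exp (-((L + Real.log p) * t))) := by
    rw [MeasureTheory.integral_finsetSum _ hint]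
    refine Finset.sum_congr rfl fun p _ => ?_
    rw [MeasureTheory.integral_const_mul, integral_mul_exp_neg_mul (hpos p)]
  rw [h1, ← integral_exp_neg_mul hL]
  refine MeasureTheory.setIntegral_mono_on (MeasureTheory.integrable_finsetSum _ hint)
    (integrableOn_exp_neg_mul hL) measurableSet_Ioi fun t ht => ?_
  have h2 := sum_log_div_sub_two_rpow_le (s := t) ht T hT
  have h3 : ∑ p ∈ T, Real.log p / (p - 2) * (t * Real.exp (-((L + Real.log p) * t))) =
      Real.exp (-(L * t)) * (t * ∑ p ∈ T, Real.log p / (p - 2) * (p : ℝ) ^ (-t)) := by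
    rw [Finset.mul_sum, Finset.mul_sum]
    refine Finset.sum_congr rfl fun p hp => ?_
    have hp0 : (0 : ℝ) < p := by exact_mod_cast (hT p hp).1.pos
    rw [Real.rpow_def_of_pos hp0]
    have : Real.exp (-((L + Real.log p) * t)) =
        Real.exp (-(L * t)) * Real.exp (Real.log p * -t) := by
      rw [← Real.exp_add]; congr 1; ring
    rw [this]
    ring
  rw [h3]
  exact mul_le_of_le_one_right (Real.exp_pos _).le h2

/-- The weight `p / (p - 2) * log p` of a prime. -/
noncomputable def primeWeight (p : ℕ) : ℝ := p / (p - 2) * Real.log p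

/-- The completely additive extension of `primeWeight`. -/
noncomputable def totalWeight (n : ℕ) : ℝ :=
  n.factorization.sum fun p v => v * primeWeight p

/-- The part of the mass `1 / (n log n)` that is sent from `n` to `n / p`. -/
noncomputable def massTransfer (n p : ℕ) : ℝ :=
  1 / ((n : ℝ) * Real.log n) * (n.factorization p * primeWeight p / totalWeight n)

lemma primeWeight_nonneg {p : ℕ} (hp : p.Prime) : 0 ≤ primeWeight p := by
  have h : (2 : ℝ) ≤ p := by exact_mod_cast hp.two_le
  exact mul_nonneg (div_nonneg (by linarith) (by linarith)) (Real.log_natCast_nonneg _)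

lemma primeWeight_eq {p : ℕ} (hp2 : p ≠ 2) :
    primeWeight p = Real.log p + 2 * (Real.log p / (p - 2)) := by
  have h : (p : ℝ) - 2 ≠ 0 := sub_ne_zero.2 (by exact_mod_cast hp2)
  rw [primeWeight]
  field_simp
  ring

lemma log_div_sub_two_nonneg {p : ℕ} (hp : p.Prime) :
    0 ≤ Real.log (p : ℝ) / (p - 2) := by
  have h : (2 : ℝ) ≤ p := by exact_mod_cast hp.two_le
  exact div_nonneg (Real.log_natCast_nonneg _) (by linarith)

lemma totalWeight_nonneg (n : ℕ) : 0 ≤ totalWeight n :=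
  Finset.sum_nonneg fun _ hp => mul_nonneg (Nat.cast_nonneg _)
    (primeWeight_nonneg (Nat.prime_of_mem_primeFactors hp))

lemma massTransfer_nonneg (n : ℕ) {p : ℕ} (hp : p.Prime) : 0 ≤ massTransfer n p := by
  have h1 := Real.log_natCast_nonneg n
  have h2 := primeWeight_nonneg hp
  have h3 := totalWeight_nonneg n
  unfold massTransfer
  positivity

lemma totalWeight_mul_prime {m p : ℕ} (hm : m ≠ 0) (hp : p.Prime) :
    totalWeight (m * p) = totalWeight m + primeWeight p := by
  unfold totalWeight
  rw [Nat.factorization_mul hm hp.ne_zero, Finsupp.sum_add_index' (by simp)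
    (by intro a b c; push_cast; ring), hp.factorization, Finsupp.sum_single_index (by simp)]
  simp

lemma log_le_totalWeight {m : ℕ} (hm : ∀ p, p.Prime → p ∣ m → p ≠ 2) :
    Real.log m ≤ totalWeight m := by
  rw [Real.log_nat_eq_sum_factorization, totalWeight]
  refine Finset.sum_le_sum fun p hp => ?_
  beta_reduce
  have hpp := Nat.prime_of_mem_primeFactors hp
  rw [primeWeight_eq (hm p hpp (Nat.dvd_of_mem_primeFactors hp))]
  have := log_div_sub_two_nonneg hpp
  exact mul_le_mul_of_nonneg_left (by linarith) (Nat.cast_nonneg _)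

lemma sum_factorization_mul_le {m : ℕ} (hm : ∀ p, p.Prime → p ∣ m → p ≠ 2)
    (T : Finset ℕ) :
    ∑ p ∈ T, (m.factorization p : ℝ) * (Real.log p / (p - 2)) ≤
      (totalWeight m - Real.log m) / 2 := by
  have h0 : (totalWeight m - Real.log m) / 2 =
      ∑ p ∈ m.factorization.support, (m.factorization p : ℝ) * (Real.log p / (p - 2)) := by
    rw [Real.log_nat_eq_sum_factorization, totalWeight, Finsupp.sum, Finsupp.sum,
      ← Finset.sum_sub_distrib, Finset.sum_div]
    refine Finset.sum_congr rfl fun p hp => ?_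
    have hpp := Nat.prime_of_mem_primeFactors hp
    rw [primeWeight_eq (hm p hpp (Nat.dvd_of_mem_primeFactors hp))]
    ring
  rw [h0, ← Finset.sum_filter_add_sum_filter_not T (fun p => p ∈ m.factorization.support)]
  have h1 : ∑ p ∈ T with ¬ p ∈ m.factorization.support,
      (m.factorization p : ℝ) * (Real.log p / (p - 2)) = 0 := by
    refine Finset.sum_eq_zero fun p hp => ?_
    rw [Finsupp.notMem_support_iff.1 (Finset.mem_filter.1 hp).2]
    simp
  rw [h1, add_zero]
  refine Finset.sum_le_sum_of_subset_of_nonneg (fun p hp => (Finset.mem_filter.1 hp).2) ?_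
  intro p hp _
  exact mul_nonneg (Nat.cast_nonneg _)
    (log_div_sub_two_nonneg (Nat.prime_of_mem_primeFactors hp))

/-- The mass received by `m` does not exceed `1 / (m log m)`. -/
lemma sum_massTransfer_le {m : ℕ} (hm2 : 2 ≤ m) (hm : ∀ p, p.Prime → p ∣ m → p ≠ 2)
    (T : Finset ℕ) (hT : ∀ p ∈ T, p.Prime ∧ p ≠ 2) :
    ∑ p ∈ T, massTransfer (m * p) p ≤ 1 / ((m : ℝ) * Real.log m) := by
  have hm0 : (0 : ℝ) < m := by positivity
  set L := Real.log m with hLdef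
  set W := totalWeight m with hWdef
  have hL : 0 < L := Real.log_pos (by exact_mod_cast hm2)
  have hLW : L ≤ W := log_le_totalWeight hm
  have hW : 0 < W := hL.trans_le hLW
  have hterm : ∀ p ∈ T, massTransfer (m * p) p ≤ 1 / (m : ℝ) *
      ((m.factorization p : ℝ) * (Real.log p / (p - 2)) * (1 / (L * W)) +
      1 / 2 * (Real.log p / (p - 2) * (1 / (L + Real.log p) ^ 2) +
        Real.log p / (p - 2) * (1 / (W + Real.log p) ^ 2))) := by
    intro p hp
    obtain ⟨hpp, hp2⟩ := hT p hp
    have hp0 : (0 : ℝ) < p := by exact_mod_cast hpp.pos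
    have hl : 0 < Real.log p := Real.log_pos (by exact_mod_cast hpp.one_lt)
    have hc := log_div_sub_two_nonneg hpp
    have hw : primeWeight p = p * (Real.log p / (p - 2)) := by unfold primeWeight; ring
    have hlw : Real.log p ≤ primeWeight p := by rw [primeWeight_eq hp2]; linarith
    have hlog : Real.log ((m * p : ℕ) : ℝ) = L + Real.log p := by
      rw [Nat.cast_mul, Real.log_mul hm0.ne' hp0.ne']
    unfold massTransfer
    rw [hlog, totalWeight_mul_prime (by omega) hpp,
      Nat.factorization_mul (by omega) hpp.ne_zero, Finsupp.add_apply, hpp.factorization_self]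
    set l := Real.log p
    set c := l / ((p : ℝ) - 2)
    set v := m.factorization p
    have hWw : 0 < W + primeWeight p := by linarith
    have e : 1 / (((m * p : ℕ) : ℝ) * (L + l)) *
        (((v + 1 : ℕ) : ℝ) * primeWeight p / (W + primeWeight p)) =
        1 / (m : ℝ) * (v * c * (1 / ((L + l) * (W + primeWeight p))) +
          c * (1 / ((L + l) * (W + primeWeight p)))) := by
      have hne : W + primeWeight p ≠ 0 := hWw.ne'
      rw [hw] at hne ⊢
      push_cast
      field_simp
    rw [e]
    have h1 : 1 / ((L + l) * (W + primeWeight p)) ≤ 1 / (L * W) := by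
      apply one_div_le_one_div_of_le (by positivity)
      gcongr <;> linarith
    have h2 : 1 / ((L + l) * (W + primeWeight p)) ≤
        1 / 2 * (1 / (L + l) ^ 2 + 1 / (W + l) ^ 2) := by
      have h3 : 1 / ((L + l) * (W + primeWeight p)) ≤ 1 / ((L + l) * (W + l)) := by
        apply one_div_le_one_div_of_le (by positivity)
        gcongr
      have h4 : 1 / ((L + l) * (W + l)) = 1 / (L + l) * (1 / (W + l)) := by
        rw [one_div_mul_one_div]
      have h5 : 1 / (L + l) ^ 2 = (1 / (L + l)) ^ 2 := by rw [div_pow, one_pow]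
      have h6 : 1 / (W + l) ^ 2 = (1 / (W + l)) ^ 2 := by rw [div_pow, one_pow]
      rw [h5, h6]
      rw [h4] at h3
      nlinarith [sq_nonneg (1 / (L + l) - 1 / (W + l))]
    have h7 := mul_le_mul_of_nonneg_left h1 (mul_nonneg (Nat.cast_nonneg (α := ℝ) v) hc)
    have h8 := mul_le_mul_of_nonneg_left h2 hc
    refine mul_le_mul_of_nonneg_left ?_ (by positivity)
    linarith
  refine (Finset.sum_le_sum hterm).trans ?_
  rw [← Finset.mul_sum, Finset.sum_add_distrib, ← Finset.mul_sum, Finset.sum_add_distrib,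
    ← Finset.sum_mul]
  have h1 := sum_log_div_sub_two_sq_le hL T hT
  have h2 := sum_log_div_sub_two_sq_le hW T hT
  have h3 := mul_le_mul_of_nonneg_right (sum_factorization_mul_le hm T)
    (by positivity : 0 ≤ 1 / (L * W))
  have h4 : (W - L) / 2 * (1 / (L * W)) = (1 / L - 1 / W) / 2 := by field_simp
  have h5 : 1 / ((m : ℝ) * L) = 1 / (m : ℝ) * (1 / L) := by rw [one_div_mul_one_div]
  rw [← hWdef, ← hLdef, h4] at h3
  rw [h5]
  refine mul_le_mul_of_nonneg_left ?_ (by positivity)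
  linarith

lemma sum_massTransfer_eq {n : ℕ} (hn2 : 2 ≤ n) (hn : ∀ p, p.Prime → p ∣ n → p ≠ 2) :
    ∑ p ∈ n.primeFactors, massTransfer n p = 1 / ((n : ℝ) * Real.log n) := by
  have hL : 0 < Real.log n := Real.log_pos (by exact_mod_cast hn2)
  have hW : 0 < totalWeight n := hL.trans_le (log_le_totalWeight hn)
  unfold massTransfer
  rw [← Finset.mul_sum, ← Finset.sum_div]
  have : ∑ p ∈ n.primeFactors, (n.factorization p : ℝ) * primeWeight p = totalWeight n := rfl
  rw [this, div_self hW.ne', mul_one]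

/-- All quotients of elements of `B` by one prime factor. -/
def primeQuotients (B : Finset ℕ) : Finset ℕ :=
  B.biUnion fun n => n.primeFactors.image fun p => n / p

lemma exists_of_mem_primeQuotients {B : Finset ℕ} {m : ℕ} (hm : m ∈ primeQuotients B) :
    ∃ p, p.Prime ∧ m * p ∈ B := by
  rw [primeQuotients, Finset.mem_biUnion] at hm
  obtain ⟨n, hn, hm⟩ := hm
  obtain ⟨p, hp, rfl⟩ := Finset.mem_image.1 hm
  refine ⟨p, Nat.prime_of_mem_primeFactors hp, ?_⟩
  rwa [Nat.div_mul_cancel (Nat.dvd_of_mem_primeFactors hp)]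

lemma cardFactors_mul_prime {m p : ℕ} (hm : m ≠ 0) (hp : p.Prime) :
    ArithmeticFunction.cardFactors (m * p) = ArithmeticFunction.cardFactors m + 1 := by
  rw [ArithmeticFunction.cardFactors_mul hm hp.ne_zero,
    ArithmeticFunction.cardFactors_apply_prime hp]

lemma two_le_of_one_le_cardFactors {n : ℕ}
    (hn : 1 ≤ ArithmeticFunction.cardFactors n) : 2 ≤ n := by
  rcases n with _ | _ | n
  · simp at hn
  · simp at hn
  · omega

lemma sum_le_sum_primeQuotients (B : Finset ℕ)
    (hB : ∀ n ∈ B, 2 ≤ ArithmeticFunction.cardFactors n)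
    (hodd : ∀ n ∈ B, ∀ p, p.Prime → p ∣ n → p ≠ 2) :
    ∑ n ∈ B, 1 / ((n : ℝ) * Real.log n) ≤
      ∑ n ∈ primeQuotients B, 1 / ((n : ℝ) * Real.log n) := by
  set P := B.biUnion Nat.primeFactors with hP
  have hPp : ∀ p ∈ P, p.Prime ∧ p ≠ 2 := by
    intro p hp
    obtain ⟨n, hn, hpn⟩ := Finset.mem_biUnion.1 hp
    have hpp := Nat.prime_of_mem_primeFactors hpn
    exact ⟨hpp, hodd n hn p hpp (Nat.dvd_of_mem_primeFactors hpn)⟩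
  have h1 : ∑ n ∈ B, 1 / ((n : ℝ) * Real.log n) =
      ∑ x ∈ B.sigma fun n => n.primeFactors, massTransfer x.1 x.2 := by
    rw [Finset.sum_sigma]
    refine Finset.sum_congr rfl fun n hn => (sum_massTransfer_eq ?_ (hodd n hn)).symm
    exact two_le_of_one_le_cardFactors (by have := hB n hn; omega)
  have h2 : ∑ x ∈ B.sigma (fun n => n.primeFactors), massTransfer x.1 x.2 =
      ∑ y ∈ (B.sigma fun n => n.primeFactors).image (fun x => (x.1 / x.2, x.2)),
        massTransfer (y.1 * y.2) y.2 := by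
    rw [Finset.sum_image]
    · refine Finset.sum_congr rfl fun x hx => ?_
      rw [Nat.div_mul_cancel (Nat.dvd_of_mem_primeFactors (Finset.mem_sigma.1 hx).2)]
    · rintro ⟨a, p⟩ ha ⟨b, q⟩ hb hab
      have hpa : p ∣ a := Nat.dvd_of_mem_primeFactors (Finset.mem_sigma.1 ha).2
      have hqb : q ∣ b := Nat.dvd_of_mem_primeFactors (Finset.mem_sigma.1 hb).2
      simp only [Prod.mk.injEq] at hab
      obtain ⟨h, rfl⟩ := hab
      have : a = b := by
        rw [← Nat.div_mul_cancel hpa, h, Nat.div_mul_cancel hqb]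
      rw [this]
  have h3 : (B.sigma fun n => n.primeFactors).image (fun x => (x.1 / x.2, x.2)) ⊆
      primeQuotients B ×ˢ P := by
    intro y hy
    obtain ⟨⟨n, p⟩, hx, rfl⟩ := Finset.mem_image.1 hy
    obtain ⟨hn, hp⟩ := Finset.mem_sigma.1 hx
    exact Finset.mem_product.2 ⟨Finset.mem_biUnion.2 ⟨n, hn, Finset.mem_image.2 ⟨p, hp, rfl⟩⟩,
      Finset.mem_biUnion.2 ⟨n, hn, hp⟩⟩
  rw [h1, h2]
  refine (Finset.sum_le_sum_of_subset_of_nonneg h3 fun y hy _ =>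
    massTransfer_nonneg _ (hPp _ (Finset.mem_product.1 hy).2).1).trans ?_
  rw [Finset.sum_product]
  refine Finset.sum_le_sum fun m hm => ?_
  obtain ⟨p, hp, hmp⟩ := exists_of_mem_primeQuotients hm
  have hm0 : m ≠ 0 := by
    rintro rfl
    have := hB _ hmp
    simp at this
  refine sum_massTransfer_le (two_le_of_one_le_cardFactors ?_)
    (fun q hq hqm => hodd _ hmp q hq (hqm.mul_right p)) P hPp
  have := hB _ hmp
  rw [cardFactors_mul_prime hm0 hp] at this
  omega

lemma eq_of_dvd_of_cardFactors_le {a b : ℕ} (hb : b ≠ 0) (h : a ∣ b)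
    (hc : ArithmeticFunction.cardFactors b ≤ ArithmeticFunction.cardFactors a) : a = b := by
  obtain ⟨c, rfl⟩ := h
  have ha : a ≠ 0 := left_ne_zero_of_mul hb
  have hc0 : c ≠ 0 := right_ne_zero_of_mul hb
  rw [ArithmeticFunction.cardFactors_mul ha hc0] at hc
  have h0 : ArithmeticFunction.cardFactors c = 0 := by omega
  rcases ArithmeticFunction.cardFactors_eq_zero_iff_eq_zero_or_one.1 h0 with h | h
  · exact absurd h hc0
  · rw [h, mul_one]

/-- A finite primitive set can be pushed down to the level `Ω = k` without decreasing the sum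
of `1 / (n log n)`. -/
lemma exists_finset_cardFactors_eq {k : ℕ} (hk : 1 ≤ k) {Q : Set ℕ}
    (hQ : ∀ p ∈ Q, p ≠ 2) (d : ℕ) (A : Finset ℕ) (hA : Primitive (A : Set ℕ))
    (hAQ : ∀ n ∈ A, ∀ p : ℕ, p.Prime → p ∣ n → p ∈ Q)
    (hAk : ∀ n ∈ A, k ≤ ArithmeticFunction.cardFactors n)
    (hAd : ∀ n ∈ A, ArithmeticFunction.cardFactors n ≤ k + d) :
    ∃ B : Finset ℕ, (∀ n ∈ B, ArithmeticFunction.cardFactors n = k ∧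
        ∀ p : ℕ, p.Prime → p ∣ n → p ∈ Q) ∧
      ∑ n ∈ A, 1 / ((n : ℝ) * Real.log n) ≤ ∑ n ∈ B, 1 / ((n : ℝ) * Real.log n) := by
  induction d generalizing A with
  | zero => exact ⟨A, fun n hn => ⟨le_antisymm (hAd n hn) (hAk n hn), hAQ n hn⟩, le_rfl⟩
  | succ d ih =>
    set top := A.filter fun n => ArithmeticFunction.cardFactors n = k + d + 1
    set rest := A.filter fun n => ¬ ArithmeticFunction.cardFactors n = k + d + 1
    have hC : ∀ m ∈ primeQuotients top, ∃ p, p.Prime ∧ m * p ∈ A ∧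
        ArithmeticFunction.cardFactors (m * p) = k + d + 1 ∧ m ≠ 0 ∧
        ArithmeticFunction.cardFactors m = k + d := by
      intro m hm
      obtain ⟨p, hp, hmp⟩ := exists_of_mem_primeQuotients hm
      obtain ⟨h1, h2⟩ := Finset.mem_filter.1 hmp
      have hm0 : m ≠ 0 := by
        rintro rfl
        simp at h2
      refine ⟨p, hp, h1, h2, hm0, ?_⟩
      rw [cardFactors_mul_prime hm0 hp] at h2
      omega
    have hR : ∀ m ∈ rest, m ∈ A ∧ m ≠ 0 ∧ ArithmeticFunction.cardFactors m ≤ k + d := by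
      intro m hm
      obtain ⟨h1, h2⟩ := Finset.mem_filter.1 hm
      have := hAd m h1
      have := two_le_of_one_le_cardFactors (hk.trans (hAk m h1))
      exact ⟨h1, by omega, by omega⟩
    have hRC : ∀ a ∈ rest, ∀ b ∈ primeQuotients top, ¬ a ∣ b := by
      intro a ha b hb hab
      obtain ⟨p, hp, hbA, hbΩ, -⟩ := hC b hb
      obtain ⟨haA, -, haΩ⟩ := hR a ha
      refine hA a haA (b * p) hbA ?_ (hab.mul_right p)
      rintro rfl
      omega
    have hdisj : Disjoint rest (primeQuotients top) :=
      Finset.disjoint_left.2 fun a ha hb => hRC a ha a hb dvd_rfl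
    have hUprim : Primitive ((rest ∪ primeQuotients top : Finset ℕ) : Set ℕ) := by
      intro a ha b hb hne hab
      rw [Finset.mem_coe, Finset.mem_union] at ha hb
      rcases ha with ha | ha
      · rcases hb with hb | hb
        · exact hA a (hR a ha).1 b (hR b hb).1 hne hab
        · exact hRC a ha b hb hab
      · obtain ⟨-, -, -, -, -, haΩ⟩ := hC a ha
        rcases hb with hb | hb
        · obtain ⟨-, hb0, hbΩ⟩ := hR b hb
          exact hne (eq_of_dvd_of_cardFactors_le hb0 hab (by omega))
        · obtain ⟨-, -, -, -, hb0, hbΩ⟩ := hC b hb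
          exact hne (eq_of_dvd_of_cardFactors_le hb0 hab (by omega))
    have hUQ : ∀ n ∈ rest ∪ primeQuotients top, ∀ p : ℕ, p.Prime → p ∣ n → p ∈ Q := by
      intro n hn p hp hpn
      rcases Finset.mem_union.1 hn with hn | hn
      · exact hAQ n (hR n hn).1 p hp hpn
      · obtain ⟨q, -, hqA, -⟩ := hC n hn
        exact hAQ _ hqA p hp (hpn.mul_right q)
    have hUk : ∀ n ∈ rest ∪ primeQuotients top, k ≤ ArithmeticFunction.cardFactors n := by
      intro n hn
      rcases Finset.mem_union.1 hn with hn | hn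
      · exact hAk n (hR n hn).1
      · obtain ⟨-, -, -, -, -, hΩ⟩ := hC n hn
        omega
    have hUd : ∀ n ∈ rest ∪ primeQuotients top, ArithmeticFunction.cardFactors n ≤ k + d := by
      intro n hn
      rcases Finset.mem_union.1 hn with hn | hn
      · exact (hR n hn).2.2
      · obtain ⟨-, -, -, -, -, hΩ⟩ := hC n hn
        omega
    obtain ⟨B, hB, hle⟩ := ih _ hUprim hUQ hUk hUd
    refine ⟨B, hB, le_trans ?_ hle⟩
    rw [Finset.sum_union hdisj, ← Finset.sum_filter_add_sum_filter_not A
      (fun n => ArithmeticFunction.cardFactors n = k + d + 1), add_comm]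
    refine add_le_add_right (sum_le_sum_primeQuotients top ?_ ?_) _
    · intro n hn
      have := (Finset.mem_filter.1 hn).2
      omega
    · intro n hn p hp hpn
      exact hQ p (hAQ n (Finset.mem_filter.1 hn).1 p hp hpn)

lemma sum_primes_le (T : Finset ℕ) (hT : ∀ p ∈ T, p.Prime ∧ p ≠ 2) :
    ∑ p ∈ T, 1 / ((p : ℝ) * Real.log p) ≤ 4 * (1 / Real.log 3) := by
  have hl3 : 0 < Real.log 3 := Real.log_pos (by norm_num)
  refine le_trans ?_ (mul_le_mul_of_nonneg_left (sum_log_div_sub_two_sq_le hl3 T hT)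
    (by norm_num : (0 : ℝ) ≤ 4))
  rw [Finset.mul_sum]
  refine Finset.sum_le_sum fun p hp => ?_
  have hp3 : 3 ≤ p := by
    have := (hT p hp).1.two_le
    have := (hT p hp).2
    omega
  have hR : (3 : ℝ) ≤ p := by exact_mod_cast hp3
  have hl : Real.log 3 ≤ Real.log p := Real.log_le_log (by norm_num) hR
  have hl0 : 0 < Real.log (p : ℝ) := hl3.trans_le hl
  have h2 : (0 : ℝ) < p - 2 := by linarith
  have h1 : 1 / (2 * Real.log (p : ℝ)) ^ 2 ≤ 1 / (Real.log 3 + Real.log p) ^ 2 := by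
    apply one_div_le_one_div_of_le (by positivity)
    gcongr
    linarith
  calc 1 / ((p : ℝ) * Real.log p) ≤ 1 / ((p - 2) * Real.log p) := by
        apply one_div_le_one_div_of_le (by positivity)
        gcongr
        linarith
    _ = 4 * (Real.log p / (p - 2) * (1 / (2 * Real.log (p : ℝ)) ^ 2)) := by
        field_simp
        norm_num
    _ ≤ _ := by gcongr

lemma sum_le_of_subtype {k : ℕ} (hk : 1 ≤ k) {A Q : Set ℕ} (hA : Primitive A)
    (hAk : ∀ n ∈ A, k ≤ ArithmeticFunction.cardFactors n) (hQ : ∀ p ∈ Q, p ≠ 2)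
    (F : Finset (restrictPrimes A Q)) :
    ∃ B : Finset ℕ, (∀ n ∈ B, ArithmeticFunction.cardFactors n = k ∧
        ∀ p : ℕ, p.Prime → p ∣ n → p ∈ Q) ∧
      ∑ a ∈ F, 1 / (((a : ℕ) : ℝ) * Real.log ((a : ℕ) : ℝ)) ≤
        ∑ n ∈ B, 1 / ((n : ℝ) * Real.log n) := by
  set A' := F.map (Function.Embedding.subtype _) with hA'
  have hmem : ∀ n ∈ A', n ∈ restrictPrimes A Q := by
    intro n hn
    obtain ⟨a, -, rfl⟩ := Finset.mem_map.1 hn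
    exact a.2
  obtain ⟨B, hB, hle⟩ := exists_finset_cardFactors_eq hk hQ
    (A'.sup fun n => ArithmeticFunction.cardFactors n) A'
    (fun a ha b hb => hA a (hmem a ha).1 b (hmem b hb).1) (fun n hn => (hmem n hn).2)
    (fun n hn => hAk n (hmem n hn).1)
    (fun n hn => (Finset.le_sup (f := fun n => ArithmeticFunction.cardFactors n) hn).trans
      (Nat.le_add_left _ _))
  refine ⟨B, hB, le_trans (le_of_eq ?_) hle⟩
  rw [hA', Finset.sum_map]
  rfl

lemma one_div_mul_log_nonneg (n : ℕ) : 0 ≤ 1 / ((n : ℝ) * Real.log n) :=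
  one_div_nonneg.2 (mul_nonneg (Nat.cast_nonneg _) (Real.log_natCast_nonneg _))

lemma primitive_cardFactors_eq {k : ℕ} (hk : 1 ≤ k) :
    Primitive {n : ℕ | ArithmeticFunction.cardFactors n = k} := by
  intro a ha b hb hne hab
  rw [Set.mem_ofPred_eq] at ha hb
  have hb2 := two_le_of_one_le_cardFactors (hk.trans hb.ge)
  exact hne (eq_of_dvd_of_cardFactors_le (by omega) hab (by omega))

lemma summable_cardFactors_eq {k : ℕ} (hk : 1 ≤ k) {Q : Set ℕ} (hQ : ∀ p ∈ Q, p ≠ 2) :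
    Summable fun a : restrictPrimes {n : ℕ | ArithmeticFunction.cardFactors n = k} Q =>
      1 / (((a : ℕ) : ℝ) * Real.log ((a : ℕ) : ℝ)) := by
  refine summable_of_sum_le (c := 4 * (1 / Real.log 3))
    (fun a => one_div_mul_log_nonneg a) fun F => ?_
  obtain ⟨B, hB, hle⟩ := sum_le_of_subtype le_rfl (primitive_cardFactors_eq hk)
    (fun n hn => hk.trans (le_of_eq hn.symm)) hQ F
  refine hle.trans (sum_primes_le B fun p hp => ?_)
  have hpp : p.Prime := ArithmeticFunction.cardFactors_eq_one_iff_prime.1 (hB p hp).1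
  exact ⟨hpp, hQ p ((hB p hp).2 p hpp dvd_rfl)⟩

theorem odd_banks_martin (k : ℕ) (hk : 1 ≤ k) (A : Set ℕ) (hA : Primitive A)
    (hAk : ∀ n ∈ A, k ≤ ArithmeticFunction.cardFactors n)
    (Q : Set ℕ) (hQ : ∀ p ∈ Q, p.Prime ∧ p ≠ 2) :
    fSet (restrictPrimes A Q) ≤
      fSet (restrictPrimes {n : ℕ | ArithmeticFunction.cardFactors n = k} Q) := by
  have hQ' : ∀ p ∈ Q, p ≠ 2 := fun p hp => (hQ p hp).2
  refine Real.tsum_le_of_sum_le (fun a => one_div_mul_log_nonneg a) fun F => ?_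
  obtain ⟨B, hB, hle⟩ := sum_le_of_subtype hk hA hAk hQ' F
  refine hle.trans ?_
  classical
  have h := (summable_cardFactors_eq hk hQ').sum_le_tsum
    (B.subtype fun n => n ∈ restrictPrimes {n : ℕ | ArithmeticFunction.cardFactors n = k} Q)
    (fun a _ => one_div_mul_log_nonneg a)
  rwa [Finset.sum_subtype_of_mem
    (p := fun n => n ∈ restrictPrimes {n : ℕ | ArithmeticFunction.cardFactors n = k} Q)
    (fun n : ℕ => 1 / ((n : ℝ) * Real.log n))
    (fun n hn => hB n hn)] at h
end
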